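/- arXiv:1507.05484 — 3 statements merged into one kernel-verified Lean document; each statement's English description precedes it below -/
import Mathlib

section
/- For every n ≥ 1 and every m ≥ 1, the number F_{n,m} of tree-encoding functions f : Fin n → Fin n with exactly m ascending runs satisfies (as an identity of integers) F_{n,m} = C(n−1, m−1) · Σ_{ℓ=0}^{m−1} (−1)^{m−1−ℓ} · C(m−1, ℓ) · (ℓ+1)^{n−1}, where C(a,b) denotes the binomial coefficient. -/
/-- A function `f : Fin n → Fin n` encodes a rooted labelled tree (Cayley tree)
on `n` vertices. -/
def IsTreeMap {n : ℕ} (f : Fin n → Fin n) : Prop :=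
  ∃ r : Fin n, f r = r ∧ ∀ i : Fin n, ∃ k : ℕ, f^[k] i = r

/-- The number of ascending runs of `f`: the number of elements `j` that are the
start of an ascending run, i.e. every preimage `i` of `j` satisfies `j ≤ i`. -/
def numRuns {n : ℕ} (f : Fin n → Fin n) : ℕ :=
  (Finset.univ.filter (fun j : Fin n => ∀ i : Fin n, f i = j → j ≤ i)).card

/-- `F_{n,m}`: the number of tree-encoding functions on `Fin n` with exactly
`m` ascending runs. -/
noncomputable def treeRunCount (n m : ℕ) : ℕ :=
  Nat.card {f : Fin n → Fin n // IsTreeMap f ∧ numRuns f = m}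

section TreeDeterminant

open Matrix Finset

variable {n : ℕ}

/-- The row contributed by an arrow `i → j`; a loop contributes the all-ones row. -/
def arrowRow (i j : Fin n) : Fin n → ℤ :=
  if j = i then 1 else Pi.single i 1 - Pi.single j 1

theorem arrowRow_dotProduct (i j : Fin n) (v : Fin n → ℤ) :
    arrowRow i j ⬝ᵥ v = if j = i then ∑ k, v k else v i - v j := by
  unfold arrowRow
  split_ifs with h
  · exact one_dotProduct v
  · simp [sub_dotProduct]

theorem det_arrowRow_eq_zero_of_no_fixed (hn : 1 ≤ n) (f : Fin n → Fin n)
    (hf : ∀ i, f i ≠ i) : (Matrix.of fun i => arrowRow i (f i)).det = 0 := by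
  refine exists_mulVec_eq_zero_iff.mp ⟨1, ?_, ?_⟩
  · intro h
    simpa using congrFun h ⟨0, hn⟩
  · ext i
    exact (arrowRow_dotProduct i (f i) 1).trans (by simp [hf i])

theorem det_arrowRow_eq_zero_of_not_reaching (f : Fin n → Fin n) {r c : Fin n} (hr : f r = r)
    (hc : ∀ k : ℕ, f^[k] c ≠ r) : (Matrix.of fun i => arrowRow i (f i)).det = 0 := by
  classical
  let C : Finset (Fin n) := {i | ∃ k : ℕ, f^[k] i = r}
  have hC (i : Fin n) : f i ∈ C ↔ i ∈ C := by
    simp only [C, mem_filter, mem_univ, true_and]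
    constructor
    · rintro ⟨k, hk⟩
      exact ⟨k + 1, hk⟩
    · rintro ⟨k, hk⟩
      refine ⟨k, ?_⟩
      rw [← Function.iterate_succ_apply, Function.iterate_succ_apply', hk, hr]
  have hrC : r ∈ C := mem_filter.mpr ⟨mem_univ r, 0, rfl⟩
  have hcC : c ∉ C := by simpa [C] using hc
  let h : Fin n → ℤ := fun i => if i ∈ C then (#Cᶜ : ℤ) else -(#C : ℤ)
  have hsum : ∑ i, h i = 0 := by
    simp only [h]
    rw [sum_ite, sum_const, sum_const, ← compl_filter]
    simp only [filter_univ_mem]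
    simp
    ring
  refine exists_mulVec_eq_zero_iff.mp ⟨h, ?_, ?_⟩
  · intro h0
    have := congrFun h0 r
    simp only [h, hrC, if_true, Pi.zero_apply, Nat.cast_eq_zero, card_eq_zero] at this
    have hc' : c ∈ Cᶜ := mem_compl.mpr hcC
    simp [this] at hc'
  · ext i
    refine (arrowRow_dotProduct i (f i) h).trans ?_
    simp [hsum, h, hC]

theorem det_single_root_eq_one (f : Fin n → Fin n) {r : Fin n}
    (hf : ∀ i : Fin n, ∃ k : ℕ, f^[k] i = r) :
    ((Matrix.of fun i => if i = r then Pi.single i 1 else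
      Pi.single i 1 - Pi.single (f i) 1 : Matrix (Fin n) (Fin n) ℤ)).det = 1 := by
  classical
  let d : Fin n → ℕ := fun i => Nat.find (hf i)
  have hd (i : Fin n) (hi : i ≠ r) : d (f i) < d i := by
    have hspec : f^[d i] i = r := Nat.find_spec (hf i)
    rcases Nat.eq_zero_or_eq_succ_pred (d i) with h0 | hk
    · rw [h0] at hspec
      exact absurd hspec hi
    · rw [hk, Function.iterate_succ_apply] at hspec
      have : d (f i) ≤ (d i).pred := Nat.find_min' (hf (f i)) hspec
      omega
  have hM : BlockTriangular (Matrix.of fun i => if i = r then Pi.single i 1 else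
      Pi.single i 1 - Pi.single (f i) 1 : Matrix (Fin n) (Fin n) ℤ)
      (OrderDual.toDual ∘ d) := by
    intro i j hij
    have hij : d i < d j := hij
    have hne : j ≠ i := by rintro rfl; exact lt_irrefl _ hij
    by_cases hi : i = r
    · simp [hi, hi ▸ hne]
    · have hne' : j ≠ f i := by rintro rfl; exact lt_asymm hij (hd i hi)
      simp [hi, hne, hne']
  rw [hM.det]
  refine prod_eq_one fun a _ => ?_
  refine Eq.trans (congrArg det ?_) det_one
  ext ⟨i, hi⟩ ⟨j, hj⟩
  have hdd : d i = d j := OrderDual.toDual.injective (hi.trans hj.symm)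
  by_cases h : i = r
  · simp [toSquareBlock_def, h, Matrix.one_apply, Pi.single_apply, eq_comm]
  · have hne' : j ≠ f i := by rintro rfl; exact (hd i h).ne' hdd
    simp [toSquareBlock_def, h, Matrix.one_apply, Pi.single_apply, hne', eq_comm (a := i)]

theorem det_arrowRow_of_isTreeMap (f : Fin n → Fin n) (hf : IsTreeMap f) :
    (Matrix.of fun i => arrowRow i (f i)).det = n := by
  obtain ⟨r, hr, hreach⟩ := hf
  have hfix (i : Fin n) : f i = i ↔ i = r := by
    refine ⟨fun hi => ?_, fun h => h ▸ hr⟩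
    obtain ⟨k, hk⟩ := hreach i
    rwa [Function.iterate_fixed hi] at hk
  set M : Matrix (Fin n) (Fin n) ℤ := Matrix.of fun i => if i = r then Pi.single i 1 else
      Pi.single i 1 - Pi.single (f i) 1 with hM
  have hdet : M.det = 1 := det_single_root_eq_one f hreach
  have hrow : (Matrix.of fun i => arrowRow i (f i)) =
      M.updateRow r (∑ j ∈ univ, Pi.single j 1) := by
    ext i k
    by_cases h : i = r
    · subst h
      simp [arrowRow, hr, Pi.single_apply]
    · simp [arrowRow, hfix, h, hM]
  have hM1 : M *ᵥ 1 = Pi.single r 1 := by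
    ext i
    by_cases h : i = r
    · simp [hM, mulVec, h]
    · simp only [hM, mulVec, of_apply, h, if_false]
      rw [sub_dotProduct]
      simp [h]
  have hadj : M.adjugate *ᵥ Pi.single r 1 = 1 := by
    rw [← hM1, mulVec_mulVec, adjugate_mul, hdet]
    simp
  have hexp : (M.updateRow r (∑ j ∈ univ, Pi.single j 1)).det =
      ∑ j, (M.updateRow r (Pi.single j 1)).det :=
    (detRowAlternating (R := ℤ)).toMultilinearMap.map_update_sum univ r
      (fun j => (Pi.single j 1 : Fin n → ℤ)) M
  rw [hrow, hexp]
  have (j : Fin n) : (M.updateRow r (Pi.single j 1)).det = 1 := by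
    rw [← adjugate_apply]
    simpa using congrFun hadj j
  simp [this]

open Classical in
theorem det_arrowRow (hn : 1 ≤ n) (f : Fin n → Fin n) :
    (Matrix.of fun i => arrowRow i (f i)).det = if IsTreeMap f then (n : ℤ) else 0 := by
  split_ifs with hf
  · exact det_arrowRow_of_isTreeMap f hf
  · by_cases hfix : ∃ r, f r = r
    · obtain ⟨r, hr⟩ := hfix
      have : ∃ c, ∀ k : ℕ, f^[k] c ≠ r := by
        by_contra! h
        exact hf ⟨r, hr, h⟩
      obtain ⟨c, hc⟩ := this
      exact det_arrowRow_eq_zero_of_not_reaching f hr hc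
    · exact det_arrowRow_eq_zero_of_no_fixed hn f fun i hi => hfix ⟨i, hi⟩

open Classical in
/-- Tree maps with prescribed sets of allowed parents are counted, up to the factor `n`, by a
determinant. -/
theorem card_isTreeMap_piFinset (hn : 1 ≤ n) (S : Fin n → Finset (Fin n)) :
    (n : ℤ) * #{f ∈ Fintype.piFinset S | IsTreeMap f} =
      (Matrix.of fun i => ∑ k ∈ S i, arrowRow i k).det := by
  have h := (detRowAlternating (R := ℤ) (n := Fin n)).toMultilinearMap.map_sum_finset
    (fun i k => arrowRow i k) S
  refine Eq.trans ?_ h.symm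
  refine Eq.trans ?_ (sum_congr rfl fun f _ => (det_arrowRow hn f).symm)
  rw [← sum_filter, sum_const, nsmul_eq_mul, mul_comm]

open Classical in
theorem card_isTreeMap_piFinset_eq_prod (hn : 1 ≤ n) (A : Finset (Fin n)) :
    n * #{f ∈ Fintype.piFinset fun i => {k | k ≤ i ∨ k ∈ A} | IsTreeMap f} =
      #(Fintype.piFinset fun i : Fin n => ({k | k ≤ i ∨ k ∈ A} : Finset (Fin n))) := by
  set S : Fin n → Finset (Fin n) := fun i => {k | k ≤ i ∨ k ∈ A} with hS
  have hmem (i k : Fin n) : k ∈ S i ↔ k ≤ i ∨ k ∈ A := by simp [hS]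
  have hentry (i k : Fin n) : (∑ j ∈ S i, arrowRow i j) k =
      1 + (if k = i then (#(S i) : ℤ) else 0) - if k ∈ S i then 1 else 0 := by
    have hrow (j : Fin n) : arrowRow i j k =
        (if j = i then 1 else 0) + (if k = i then 1 else 0) - if k = j then 1 else 0 := by
      unfold arrowRow
      by_cases h : j = i
      · simp [h]
      · simp [h, Pi.single_apply]
    rw [Finset.sum_apply, sum_congr rfl fun j _ => hrow j, sum_sub_distrib, sum_add_distrib]
    simp [hmem]
  have htri : (Matrix.of fun i => ∑ k ∈ S i, arrowRow i k).BlockTriangular id := by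
    intro i k hki
    have hki : k < i := hki
    simp [hentry, hmem, hki.le, hki.ne, -Finset.sum_apply]
  zify
  rw [card_isTreeMap_piFinset hn S, det_of_isUpperTriangular htri, Fintype.card_piFinset]
  simp [hentry, hmem, -Finset.sum_apply]

end TreeDeterminant

section Stirling

open Finset

theorem alternating_sum_choose_mul_succ_pow (N M : ℕ) :
    ∑ ℓ ∈ range (M + 1), (-1 : ℤ) ^ (M - ℓ) * (Nat.choose M ℓ : ℤ) * ((ℓ : ℤ) + 1) ^ N =
      M.factorial * Nat.stirlingSecond (N + 1) (M + 1) := by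
  induction N generalizing M with
  | zero =>
    have h : ∑ ℓ ∈ range (M + 1), (-1 : ℤ) ^ (M - ℓ) * (Nat.choose M ℓ : ℤ) =
        if M = 0 then 1 else 0 := by
      rw [← Int.alternating_sum_range_choose, ← sum_range_reflect]
      refine sum_congr rfl fun ℓ hℓ => ?_
      have hℓ : ℓ ≤ M := Nat.lt_succ_iff.mp (mem_range.mp hℓ)
      rw [show M + 1 - 1 - ℓ = M - ℓ by omega, Nat.choose_symm hℓ, Nat.sub_sub_self hℓ]
    simp only [pow_zero, mul_one, h]
    cases M <;> simp [Nat.stirlingSecond_succ_succ]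
  | succ N ih =>
    cases M with
    | zero => simp [Nat.stirlingSecond_one_right]
    | succ M =>
      have hterm : ∀ ℓ ∈ range (M + 2),
          (-1 : ℤ) ^ (M + 1 - ℓ) * (Nat.choose (M + 1) ℓ : ℤ) * ((ℓ : ℤ) + 1) ^ (N + 1) =
          (M + 2) * ((-1 : ℤ) ^ (M + 1 - ℓ) * (Nat.choose (M + 1) ℓ : ℤ) * ((ℓ : ℤ) + 1) ^ N) +
          (M + 1) * ((-1 : ℤ) ^ (M - ℓ) * (Nat.choose M ℓ : ℤ) * ((ℓ : ℤ) + 1) ^ N) := by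
        intro ℓ hℓ
        rcases Nat.lt_or_ge M ℓ with h | h
        · obtain rfl : ℓ = M + 1 := by have := mem_range.mp hℓ; omega
          simp
          ring
        · have hc : (Nat.choose (M + 1) ℓ : ℤ) * ((M : ℤ) + 1 - ℓ) = (M + 1) * Nat.choose M ℓ := by
            have h1 := Nat.choose_mul_succ_eq M ℓ
            zify [show ℓ ≤ M + 1 by omega] at h1
            linarith
          rw [show M + 1 - ℓ = M - ℓ + 1 by omega]
          linear_combination ((-1 : ℤ) ^ (M - ℓ) * ((ℓ : ℤ) + 1) ^ N) * hc
      rw [sum_congr rfl hterm, sum_add_distrib, ← mul_sum, ← mul_sum, ih (M + 1),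
        sum_range_succ _ (M + 1), Nat.choose_succ_self, ih M,
        Nat.stirlingSecond_succ_succ (N + 1) (M + 1), Nat.factorial_succ]
      push_cast
      ring

end Stirling

section RunStarts

open Finset

/-- The starts `j < s` of a partial map on `{0, …, s - 1}`, for the reversed order. -/
def runStarts {n s : ℕ} (g : Fin s → Fin n) : Finset ℕ :=
  {j ∈ range s | ∀ t : Fin s, (g t : ℕ) = j → (t : ℕ) ≤ j}

theorem runStarts_snoc {n s : ℕ} (g : Fin s → Fin n) (x : Fin n) :
    runStarts (Fin.snoc g x : Fin (s + 1) → Fin n) = insert s ((runStarts g).erase x) := by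
  ext j
  simp only [runStarts, mem_filter, mem_range, mem_insert, mem_erase, Fin.forall_fin_succ',
    Fin.snoc_castSucc, Fin.snoc_last, Fin.val_castSucc, Fin.val_last]
  constructor
  · rintro ⟨hj, h1, h2⟩
    rcases Nat.lt_succ_iff_lt_or_eq.mp hj with h | h
    · exact Or.inr ⟨fun h' => absurd (h2 h'.symm) (by omega), h, h1⟩
    · exact Or.inl h
  · rintro (rfl | ⟨hne, hj, h⟩)
    · exact ⟨by omega, fun t _ => t.2.le, fun _ => le_rfl⟩
    · exact ⟨by omega, h, fun h' => absurd h'.symm hne⟩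

theorem card_runStarts_snoc {n s : ℕ} (g : Fin s → Fin n) (x : Fin n) :
    #(runStarts (Fin.snoc g x : Fin (s + 1) → Fin n)) =
      if (x : ℕ) ∈ runStarts g then #(runStarts g) else #(runStarts g) + 1 := by
  have hs : s ∉ (runStarts g).erase x := by simp [runStarts]
  rw [runStarts_snoc, card_insert_of_notMem hs]
  split_ifs with h
  · exact card_erase_add_one h
  · rw [erase_eq_of_notMem h]

theorem card_filter_mem_runStarts {n s : ℕ} (hs : s ≤ n) (g : Fin s → Fin n) :
    #{x : Fin n | (x : ℕ) ∈ runStarts g} = #(runStarts g) := by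
  refine card_bij (fun x _ => (x : ℕ)) (by simp) (fun _ _ _ _ h => Fin.ext h) fun j hj => ?_
  have : j < s := by simpa using (mem_filter.mp hj).1
  exact ⟨⟨j, by omega⟩, by simpa using hj, rfl⟩

theorem card_filter_card_runStarts {n s : ℕ} (hs : s ≤ n) (r : ℕ) :
    #{g : Fin s → Fin n | #(runStarts g) = r} = n.descFactorial r * Nat.stirlingSecond s r := by
  induction s generalizing r with
  | zero => cases r <;> simp [runStarts]
  | succ s ih =>
    have hs' : s ≤ n := by omega
    cases r with
    | zero =>
      simp only [Nat.stirlingSecond_succ_zero, mul_zero, card_eq_zero]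
      refine filter_eq_empty_iff.mpr fun g _ h => ?_
      have : s ∈ runStarts g := by
        simp only [runStarts, mem_filter, mem_range]
        exact ⟨by omega, fun t _ => by omega⟩
      simp [h] at this
    | succ r =>
      have hfib (g : Fin s → Fin n) :
          #{x : Fin n | #(runStarts (Fin.snoc g x : Fin (s + 1) → Fin n)) = r + 1} =
            (if #(runStarts g) = r + 1 then r + 1 else 0) +
              if #(runStarts g) = r then n - r else 0 := by
        simp only [card_runStarts_snoc]
        have hcard := card_filter_mem_runStarts hs' g
        rcases eq_or_ne (#(runStarts g)) (r + 1) with h | h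
        · rw [h] at hcard ⊢
          simp [hcard]
        · rcases eq_or_ne (#(runStarts g)) r with h' | h'
          · have hc := card_filter_add_card_filter_not (s := (univ : Finset (Fin n)))
              (fun x : Fin n => (x : ℕ) ∈ runStarts g)
            rw [card_univ, Fintype.card_fin] at hc
            rw [h'] at hcard ⊢
            simp
            omega
          · simp only [h, h', if_false, add_zero, card_eq_zero]
            refine filter_eq_empty_iff.mpr fun x _ => ?_
            split_ifs <;> omega
      have hsplit : #{g : Fin (s + 1) → Fin n | #(runStarts g) = r + 1} =
          ∑ g : Fin s → Fin n,
            #{x : Fin n | #(runStarts (Fin.snoc g x : Fin (s + 1) → Fin n)) = r + 1} := by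
        simp only [card_filter]
        rw [← (Fin.snocEquiv fun _ : Fin (s + 1) => Fin n).sum_comp, Fintype.sum_prod_type_right]
        rfl
      rw [hsplit, sum_congr rfl fun g _ => hfib g, sum_add_distrib, ← sum_filter, ← sum_filter,
        sum_const, sum_const, ih hs', ih hs', Nat.descFactorial_succ,
        Nat.stirlingSecond_succ_succ, smul_eq_mul, smul_eq_mul]
      ring

theorem numRuns_eq_card_runStarts_rev {n : ℕ} (f : Fin n → Fin n) :
    numRuns f = #(runStarts fun t => (f t.rev).rev) := by
  refine card_bij (fun j _ => (j.rev : ℕ)) ?_ (fun _ _ _ _ h => Fin.rev_injective (Fin.ext h)) ?_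
  · intro j hj
    simp only [mem_filter, mem_univ, true_and] at hj
    simp only [runStarts, mem_filter, mem_range]
    refine ⟨j.rev.2, fun t ht => ?_⟩
    have := hj t.rev (Fin.rev_injective (Fin.ext ht))
    rw [← Fin.le_def]
    simpa using Fin.rev_le_rev.mpr this
  · intro j hj
    simp only [runStarts, mem_filter, mem_range] at hj
    obtain ⟨hjn, hj⟩ := hj
    refine ⟨Fin.rev ⟨j, hjn⟩, ?_, by simp⟩
    simp only [mem_filter, mem_univ, true_and]
    intro i hi
    have := hj i.rev (by simp [hi])
    rw [← Fin.rev_le_rev, Fin.rev_rev]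
    exact this

theorem card_filter_numRuns (n m : ℕ) :
    #{f : Fin n → Fin n | numRuns f = m} = n.descFactorial m * Nat.stirlingSecond n m := by
  rw [← card_filter_card_runStarts le_rfl m]
  refine card_equiv (Equiv.arrowCongr Fin.revPerm Fin.revPerm) fun f => ?_
  simp only [mem_filter, mem_univ, true_and, numRuns_eq_card_runStarts_rev]
  rfl

end RunStarts

section AscentValues

open Finset

variable {n : ℕ}

/-- The elements having a strictly smaller preimage. -/
def ascentValues (f : Fin n → Fin n) : Finset (Fin n) :=
  {j | ∃ i, f i = j ∧ i < j}

theorem numRuns_eq_card_compl_ascentValues (f : Fin n → Fin n) :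
    numRuns f = #(ascentValues f)ᶜ := by
  unfold numRuns ascentValues
  congr 1
  ext j
  simp

theorem ascentValues_subset_iff (f : Fin n → Fin n) (A : Finset (Fin n)) :
    ascentValues f ⊆ A ↔ f ∈ Fintype.piFinset fun i : Fin n =>
      ({k | k ≤ i ∨ k ∈ A} : Finset (Fin n)) := by
  simp only [Fintype.mem_piFinset, mem_filter, mem_univ, true_and, subset_iff, ascentValues]
  constructor
  · intro h i
    exact (le_or_gt (f i) i).imp_right fun hi => h ⟨i, rfl, hi⟩
  · rintro h _ ⟨i, rfl, hi⟩
    exact (h i).resolve_left hi.not_ge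

open Classical in
theorem card_isTreeMap_ascentValues (hn : 1 ≤ n) (A : Finset (Fin n)) :
    n * #{f : Fin n → Fin n | IsTreeMap f ∧ ascentValues f = A} =
      #{f : Fin n → Fin n | ascentValues f = A} := by
  induction A using Finset.strongInduction with
  | H A ih =>
    have hsplit (P : (Fin n → Fin n) → Prop) :
        #{f : Fin n → Fin n | P f ∧ ascentValues f ⊆ A} =
          #{f : Fin n → Fin n | P f ∧ ascentValues f = A} +
            ∑ B ∈ A.ssubsets, #{f : Fin n → Fin n | P f ∧ ascentValues f = B} := by
      rw [card_eq_sum_card_fiberwise (f := ascentValues) (t := A.powerset)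
        fun f hf => by simpa using (mem_filter.mp hf).2.2]
      rw [← insert_erase (mem_powerset_self A), sum_insert (notMem_erase _ _)]
      have hfib (B : Finset (Fin n)) (hB : B ⊆ A) :
          #{f ∈ ({f | P f ∧ ascentValues f ⊆ A} : Finset (Fin n → Fin n)) | ascentValues f = B} =
            #{f : Fin n → Fin n | P f ∧ ascentValues f = B} := by
        congr 1
        ext f
        simp only [mem_filter, mem_univ, true_and]
        exact ⟨fun h => ⟨h.1.1, h.2⟩, fun h => ⟨⟨h.1, h.2 ▸ hB⟩, h.2⟩⟩
      rw [hfib A Subset.rfl]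
      congr 1
      exact sum_congr rfl fun B hB => hfib B (mem_powerset.mp (mem_of_mem_erase hB))
    have htree := hsplit IsTreeMap
    have hall := hsplit fun _ => True
    simp only [true_and] at hall
    have hprod := card_isTreeMap_piFinset_eq_prod hn A
    have h1 : #{f : Fin n → Fin n | IsTreeMap f ∧ ascentValues f ⊆ A} =
        #{f ∈ Fintype.piFinset fun i => {k | k ≤ i ∨ k ∈ A} | IsTreeMap f} := by
      congr 1
      ext f
      simp only [mem_filter, mem_univ, true_and, ascentValues_subset_iff]
      exact and_comm
    have h2 : #{f : Fin n → Fin n | ascentValues f ⊆ A} =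
        #(Fintype.piFinset fun i : Fin n => ({k | k ≤ i ∨ k ∈ A} : Finset (Fin n))) := by
      congr 1
      ext f
      simp only [mem_filter, mem_univ, true_and, ascentValues_subset_iff]
    rw [← h1, ← h2, htree, hall, mul_add, mul_sum,
      sum_congr rfl fun B hB => ih B (mem_ssubsets.mp hB)] at hprod
    exact Nat.add_right_cancel hprod

open Classical in
theorem mul_treeRunCount (hn : 1 ≤ n) (m : ℕ) :
    n * treeRunCount n m = #{f : Fin n → Fin n | numRuns f = m} := by
  rw [treeRunCount, Nat.card_eq_fintype_card, Fintype.card_subtype]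
  have hfib (P : (Fin n → Fin n) → Prop) :
      #{f : Fin n → Fin n | P f ∧ numRuns f = m} =
        ∑ A : Finset (Fin n) with #Aᶜ = m, #{f : Fin n → Fin n | P f ∧ ascentValues f = A} := by
    rw [card_eq_sum_card_fiberwise (f := ascentValues) (t := {A | #Aᶜ = m})
      fun f hf => by
        simpa [numRuns_eq_card_compl_ascentValues] using (mem_filter.mp hf).2.2]
    refine sum_congr rfl fun A hA => ?_
    congr 1
    ext f
    simp only [mem_filter, mem_univ, true_and, numRuns_eq_card_compl_ascentValues] at hA ⊢
    exact ⟨fun h => ⟨h.1.1, h.2⟩, fun h => ⟨⟨h.1, h.2 ▸ hA⟩, h.2⟩⟩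
  have hall := hfib fun _ => True
  simp only [true_and] at hall
  rw [hfib, hall, mul_sum]
  exact sum_congr rfl fun A _ => card_isTreeMap_ascentValues hn A

end AscentValues

theorem treeRunCount_eq_descFactorial_mul_stirlingSecond (n m : ℕ) :
    treeRunCount (n + 1) (m + 1) =
      n.descFactorial m * Nat.stirlingSecond (n + 1) (m + 1) := by
  refine Nat.eq_of_mul_eq_mul_left n.succ_pos ?_
  rw [mul_treeRunCount (by omega), ← mul_assoc, ← Nat.succ_descFactorial_succ,
    ← card_filter_numRuns]

/-- Explicit alternating-sum formula for the number of Cayley trees of size `n`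
with exactly `m` ascending runs. -/
theorem treeRunCount_explicit (n m : ℕ) (hn : 1 ≤ n) (hm : 1 ≤ m) :
    (treeRunCount n m : ℤ) =
      (Nat.choose (n - 1) (m - 1) : ℤ) *
        ∑ ℓ ∈ Finset.range m,
          (-1 : ℤ) ^ (m - 1 - ℓ) * (Nat.choose (m - 1) ℓ : ℤ) * ((ℓ : ℤ) + 1) ^ (n - 1) := by
  obtain ⟨n, rfl⟩ := Nat.exists_eq_add_of_le' hn
  obtain ⟨m, rfl⟩ := Nat.exists_eq_add_of_le' hm
  simp only [Nat.add_sub_cancel]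
  rw [alternating_sum_choose_mul_succ_pow, treeRunCount_eq_descFactorial_mul_stirlingSecond,
    Nat.descFactorial_eq_factorial_mul_choose]
  push_cast
  ring
end

section
/- For every n ≥ 1 and every m ≥ 1, the number F_{n,m} of tree-encoding functions f : Fin n → Fin n with exactly m ascending runs equals (n−1)^{\underline{m−1}} · S(n,m), the falling factorial (n−1)(n−2)⋯(n−m+1) times the Stirling number of the second kind S(n,m). -/
/-- The Stirling number of the second kind `S(n,m)`: the number of partitions of
an `n`-element set into `m` nonempty blocks. -/
noncomputable def stirlingSecond (n m : ℕ) : ℕ :=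
  Nat.card {P : Finpartition (Finset.univ : Finset (Fin n)) // P.parts.card = m}

theorem IsTreeMap.eq_of_iterate_eq {n : ℕ} {f : Fin n → Fin n} (hf : IsTreeMap f)
    {x : Fin n} {p : ℕ} (hx : f^[p + 1] x = x) : f x = x := by
  obtain ⟨r, hr, hreach⟩ := hf
  obtain ⟨q, hq⟩ := hreach x
  have h1 : f^[(p + 1) * q] x = x := by
    rw [Function.iterate_mul]
    exact Function.iterate_fixed hx q
  have h2 : (p + 1) * q = p * q + q := by ring
  rw [h2, Function.iterate_add_apply, hq, Function.iterate_fixed hr] at h1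
  rw [← h1, hr]

theorem IsTreeMap.eq_of_fixed {n : ℕ} {f : Fin n → Fin n} (hf : IsTreeMap f)
    {x y : Fin n} (hx : f x = x) (hy : f y = y) : x = y := by
  obtain ⟨r, hr, hreach⟩ := hf
  obtain ⟨p, hp⟩ := hreach x
  obtain ⟨q, hq⟩ := hreach y
  rw [Function.iterate_fixed hx] at hp
  rw [Function.iterate_fixed hy] at hq
  rw [hp, hq]

open Classical in
/-- The tree maps that agree with `g` below `k` and send every `i ≥ k` into `A i`. -/
noncomputable def treeCompletions {n : ℕ} (A : Fin n → Finset (Fin n)) (k : ℕ)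
    (g : Fin n → Fin n) : Finset (Fin n → Fin n) :=
  Finset.univ.filter fun f =>
    IsTreeMap f ∧ (∀ i : Fin n, k ≤ (i : ℕ) → f i ∈ A i) ∧ ∀ i : Fin n, (i : ℕ) < k → f i = g i

theorem mem_treeCompletions {n : ℕ} {A : Fin n → Finset (Fin n)} {k : ℕ} {f g : Fin n → Fin n} :
    f ∈ treeCompletions A k g ↔ IsTreeMap f ∧ (∀ i : Fin n, k ≤ (i : ℕ) → f i ∈ A i) ∧
      ∀ i : Fin n, (i : ℕ) < k → f i = g i := by
  simp [treeCompletions]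

theorem mem_treeCompletions_update {n : ℕ} {A : Fin n → Finset (Fin n)} {k j : Fin n}
    (hj : j ∈ A k) {f g : Fin n → Fin n} :
    f ∈ treeCompletions A (k + 1) (Function.update g k j) ↔
      f ∈ treeCompletions A k g ∧ f k = j := by
  rw [mem_treeCompletions, mem_treeCompletions]
  constructor
  · rintro ⟨hf, hA, hg⟩
    have hk : f k = j := by simpa using hg k (Nat.lt_succ_self _)
    refine ⟨⟨hf, fun i hi => ?_, fun i hi => ?_⟩, hk⟩
    · rcases hi.eq_or_lt with h | h
      · obtain rfl : k = i := Fin.ext h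
        rwa [hk]
      · exact hA i h
    · rw [hg i (by omega), Function.update_of_ne (Fin.ne_of_lt hi)]
  · rintro ⟨⟨hf, hA, hg⟩, hk⟩
    refine ⟨hf, fun i hi => hA i (by omega), fun i hi => ?_⟩
    by_cases h : i = k
    · subst h; simpa using hk
    · rw [Function.update_of_ne h]
      exact hg i (by have := Fin.val_ne_of_ne h; omega)

theorem card_treeCompletions_eq_sum {n : ℕ} (A : Fin n → Finset (Fin n)) (k : Fin n)
    (g : Fin n → Fin n) :
    (treeCompletions A k g).card =
      ∑ j ∈ A k, (treeCompletions A (k + 1) (Function.update g k j)).card := by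
  rw [Finset.card_eq_sum_card_fiberwise (f := fun f => f k) (t := A k)]
  · refine Finset.sum_congr rfl fun j hj => congrArg Finset.card ?_
    ext f
    rw [Finset.mem_filter, mem_treeCompletions_update hj]
  · intro f hf
    exact (mem_treeCompletions.1 hf).2.1 k le_rfl

/-- `c` sends each vertex to the vertex where the partial map given by `g` below `k` leads it. -/
structure IsTerminus {n : ℕ} (k : ℕ) (g c : Fin n → Fin n) : Prop where
  apply_of_le : ∀ i : Fin n, k ≤ (i : ℕ) → c i = i
  reach : ∀ v, ∃ m : ℕ, ∀ f : Fin n → Fin n,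
    (∀ i : Fin n, (i : ℕ) < k → f i = g i) → f^[m] v = c v

theorem IsTerminus.update {n : ℕ} {k : Fin n} {g c : Fin n → Fin n} (h : IsTerminus k g c)
    (j : Fin n) :
    IsTerminus (k + 1) (Function.update g k j) (fun v => if c v = k then c j else c v) := by
  have hext : ∀ f : Fin n → Fin n,
      (∀ i : Fin n, (i : ℕ) < k + 1 → f i = Function.update g k j i) →
        f k = j ∧ ∀ i : Fin n, (i : ℕ) < k → f i = g i := by
    intro f hf
    refine ⟨by simpa using hf k (Nat.lt_succ_self _), fun i hi => ?_⟩
    rw [hf i (by omega), Function.update_of_ne (Fin.ne_of_lt hi)]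
  refine ⟨fun i hi => ?_, fun v => ?_⟩
  · have hc := h.apply_of_le i (by omega)
    have hne : i ≠ k := by rintro rfl; omega
    simp [hc, hne]
  · obtain ⟨m, hm⟩ := h.reach v
    by_cases hv : c v = k
    · obtain ⟨m', hm'⟩ := h.reach j
      refine ⟨m' + (1 + m), fun f hf => ?_⟩
      obtain ⟨hk, hf'⟩ := hext f hf
      rw [Function.iterate_add_apply, Function.iterate_add_apply, hm f hf', hv,
        Function.iterate_one, hk, hm' f hf', if_pos rfl]
    · refine ⟨m, fun f hf => ?_⟩
      rw [if_neg hv, hm f (hext f hf).2]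

/-- Closing a cycle other than a loop is impossible in a tree map. -/
theorem treeCompletions_update_eq_empty {n : ℕ} {A : Fin n → Finset (Fin n)} {k j : Fin n}
    {g c : Fin n → Fin n} (h : IsTerminus k g c) (hj : j ∈ A k) (hc : c j = k) (hne : j ≠ k) :
    treeCompletions A (k + 1) (Function.update g k j) = ∅ := by
  refine Finset.eq_empty_of_forall_notMem fun f hf => ?_
  obtain ⟨hf, hk⟩ := (mem_treeCompletions_update hj).1 hf
  obtain ⟨hf, -, hg⟩ := mem_treeCompletions.1 hf
  obtain ⟨m, hm⟩ := h.reach j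
  refine hne ?_
  rw [← hk]
  exact hf.eq_of_iterate_eq (p := m) (by rw [Function.iterate_succ_apply, hk, hm f hg, hc])

theorem filter_le_eq_insert {n : ℕ} (k : Fin n) :
    (Finset.univ.filter fun i : Fin n => (k : ℕ) ≤ i) =
      insert k (Finset.univ.filter fun i : Fin n => (k : ℕ) + 1 ≤ i) := by
  ext i
  simp only [Finset.mem_filter, Finset.mem_univ, true_and, Finset.mem_insert, Fin.ext_iff]
  omega

theorem prod_filter_le {n : ℕ} (k : Fin n) (w : Fin n → ℕ) :
    ∏ i with (k : ℕ) ≤ (i : Fin n), w i = w k * ∏ i with (k : ℕ) + 1 ≤ (i : Fin n), w i := by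
  rw [filter_le_eq_insert, Finset.prod_insert (by simp)]

theorem card_treeCompletions_of_root {n : ℕ} {A : Fin n → Finset (Fin n)}
    (hA : ∀ i j, j ≤ i → j ∈ A i) (d k : ℕ) (hd : k + d = n) (g c : Fin n → Fin n)
    (h : IsTerminus k g c) (r : Fin n) (hrk : (r : ℕ) < k) (hgr : g r = r) (hcr : c r = r)
    (hroot : ∀ v, k ≤ (c v : ℕ) ∨ c v = r) :
    n * (treeCompletions A k g).card =
      (Finset.univ.filter fun v => c v = r).card * ∏ i with k ≤ (i : Fin n).val, (A i).card := by
  induction d generalizing k g c with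
  | zero =>
    obtain rfl : k = n := hd
    have hc : ∀ v, c v = r := fun v => (hroot v).resolve_left (by omega)
    have hg : treeCompletions A k g = {g} := by
      ext f
      rw [mem_treeCompletions, Finset.mem_singleton]
      constructor
      · rintro ⟨-, -, hf⟩
        exact funext fun i => hf i i.2
      · rintro rfl
        refine ⟨⟨r, hgr, fun v => ?_⟩, fun i hi => absurd i.2 (by omega), fun _ _ => rfl⟩
        obtain ⟨m, hm⟩ := h.reach v
        exact ⟨m, by rw [hm f fun _ _ => rfl, hc]⟩
    have he : (Finset.univ.filter fun i : Fin k => k ≤ i.val) = ∅ :=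
      Finset.filter_eq_empty_iff.2 fun i _ => by omega
    simp [hg, hc, he]
  | succ d ih =>
    obtain ⟨k, rfl⟩ : ∃ k' : Fin n, (k' : ℕ) = k := ⟨⟨k, by omega⟩, rfl⟩
    have hrk' : r ≠ k := by rintro rfl; omega
    have hck : c k = k := h.apply_of_le k le_rfl
    set R := ∏ i with (k : ℕ) + 1 ≤ (i : Fin n).val, (A i).card with hR
    set a := (Finset.univ.filter fun v => c v = k).card with ha
    set b := (Finset.univ.filter fun v => c v = r).card with hb
    have hterm : ∀ j ∈ A k, n * (treeCompletions A (k + 1) (Function.update g k j)).card =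
        if c j = k then 0 else if c j = r then (b + a) * R else b * R := by
      intro j hj
      split_ifs with h1 h2
      · rw [mul_eq_zero]; right
        rw [Finset.card_eq_zero]
        by_cases hjk : j = k
        · subst hjk
          refine Finset.eq_empty_of_forall_notMem fun f hf => ?_
          obtain ⟨hf, hk⟩ := (mem_treeCompletions_update hj).1 hf
          obtain ⟨hf, -, hg⟩ := mem_treeCompletions.1 hf
          exact hrk' (hf.eq_of_fixed (by rw [hg r hrk, hgr]) hk)
        · exact treeCompletions_update_eq_empty h hj h1 hjk
      all_goals
        rw [ih (k + 1) (by omega) _ _ (h.update j) (by omega)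
          (by rw [Function.update_of_ne hrk', hgr]) (by simp [hcr, hrk'])]
      · congr 1
        rw [hb, ha, ← Finset.card_union_of_disjoint]
        · congr 1
          ext v
          simp only [Finset.mem_filter, Finset.mem_univ, true_and, Finset.mem_union, h2]
          by_cases hv : c v = k <;> simp [hv]
        · rw [Finset.disjoint_filter]
          rintro v - hv
          rw [hv]; exact hrk'
      · intro v
        have := hroot v
        by_cases hv : c v = k
        · simp [hv, h2]
        · simp only [hv, if_false]
          have := Fin.val_ne_of_ne hv
          grind
      · congr 2
        ext v
        simp only [Finset.mem_filter, Finset.mem_univ, true_and]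
        by_cases hv : c v = k
        · simp [hv, h2, hrk'.symm]
        · simp [hv]
      · intro v
        have := hroot v
        have := hroot j
        have := Fin.val_ne_of_ne h1
        by_cases hv : c v = k
        · simp only [hv, if_true]
          grind
        · simp only [hv, if_false]
          have := Fin.val_ne_of_ne hv
          grind
    have hka : ((A k).filter fun j => c j = k) = Finset.univ.filter fun v => c v = k := by
      ext v
      simp only [Finset.mem_filter, Finset.mem_univ, true_and, and_iff_right_iff_imp]
      intro hv
      refine hA _ _ (not_lt.1 fun hlt => hlt.ne' ?_)
      rw [← hv, h.apply_of_le v (Fin.le_of_lt hlt)]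
    have hkb : ((A k).filter fun j => c j = r) = Finset.univ.filter fun v => c v = r := by
      ext v
      simp only [Finset.mem_filter, Finset.mem_univ, true_and, and_iff_right_iff_imp]
      intro hv
      refine hA _ _ (not_lt.1 fun hlt => ?_)
      have h3 := h.apply_of_le v (Fin.le_of_lt hlt)
      rw [hv] at h3
      subst h3
      exact absurd hlt (not_lt.2 (Fin.le_of_lt hrk))
    rw [card_treeCompletions_eq_sum, Finset.mul_sum, Finset.sum_congr rfl hterm, prod_filter_le,
      ← hR]
    have hpt : ∀ j ∈ A k, (if c j = k then 0 else if c j = r then (b + a) * R else b * R) +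
        (if c j = k then b * R else 0) = b * R + (if c j = r then a * R else 0) := by
      intro j _
      by_cases h1 : c j = k
      · simp [h1, hrk'.symm]
      · by_cases h2 : c j = r
        · simp [h2, hrk']; ring
        · simp [h1, h2]
    have hsum := Finset.sum_congr (rfl : A k = A k) hpt
    rw [Finset.sum_add_distrib, Finset.sum_add_distrib, ← Finset.sum_filter, ← Finset.sum_filter,
      hka, hkb] at hsum
    simp only [Finset.sum_const, smul_eq_mul, ← ha, ← hb] at hsum
    linarith [mul_left_comm a b R, mul_left_comm b (A k).card R]

theorem card_treeCompletions_of_no_root {n : ℕ} {A : Fin n → Finset (Fin n)}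
    (hA : ∀ i j, j ≤ i → j ∈ A i) (d k : ℕ) (hd : k + d = n) (hn : 0 < n) (g c : Fin n → Fin n)
    (h : IsTerminus k g c) (hroot : ∀ v, k ≤ (c v : ℕ)) :
    n * (treeCompletions A k g).card = ∏ i with k ≤ (i : Fin n).val, (A i).card := by
  induction d generalizing k g c with
  | zero => exact absurd (hroot ⟨0, hn⟩) (by omega)
  | succ d ih =>
    obtain ⟨k, rfl⟩ : ∃ k' : Fin n, (k' : ℕ) = k := ⟨⟨k, by omega⟩, rfl⟩
    have hck : c k = k := h.apply_of_le k le_rfl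
    set R := ∏ i with (k : ℕ) + 1 ≤ (i : Fin n).val, (A i).card with hR
    set a := (Finset.univ.filter fun v => c v = k).card with ha
    have hterm : ∀ j ∈ A k, n * (treeCompletions A (k + 1) (Function.update g k j)).card =
        if c j = k then (if j = k then a * R else 0) else R := by
      intro j hj
      split_ifs with h1 h2
      · subst h2
        have hc' : (fun v => if c v = j then c j else c v) = c := by
          ext v; split_ifs with hv <;> simp [*]
        have := h.update j
        rw [hc'] at this
        rw [card_treeCompletions_of_root hA d (j + 1) (by omega) _ _ this j (by omega)
          (by simp) hck]
        intro v
        have := hroot v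
        rw [Fin.ext_iff]
        omega
      · rw [treeCompletions_update_eq_empty h hj h1 h2, Finset.card_empty, mul_zero]
      · rw [ih (k + 1) (by omega) _ _ (h.update j)]
        intro v
        have := hroot v
        have := hroot j
        have := Fin.val_ne_of_ne h1
        by_cases hv : c v = k
        · simp only [hv, if_true]
          omega
        · simp only [hv, if_false]
          have := Fin.val_ne_of_ne hv
          omega
    have hka : ((A k).filter fun j => c j = k) = Finset.univ.filter fun v => c v = k := by
      ext v
      simp only [Finset.mem_filter, Finset.mem_univ, true_and, and_iff_right_iff_imp]
      intro hv
      refine hA _ _ (not_lt.1 fun hlt => hlt.ne' ?_)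
      rw [← hv, h.apply_of_le v (Fin.le_of_lt hlt)]
    rw [card_treeCompletions_eq_sum, Finset.mul_sum, Finset.sum_congr rfl hterm, prod_filter_le,
      ← hR]
    have hpt : ∀ j ∈ A k, (if c j = k then (if j = k then a * R else 0) else R) +
        (if c j = k then R else 0) = R + (if j = k then a * R else 0) := by
      intro j _
      by_cases h1 : c j = k
      · simp [h1]; ring
      · have : j ≠ k := by rintro rfl; exact h1 hck
        simp [h1, this]
    have hsum := Finset.sum_congr (rfl : A k = A k) hpt
    rw [Finset.sum_add_distrib, Finset.sum_add_distrib, ← Finset.sum_filter, hka,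
      Finset.sum_ite_eq', if_pos (hA k k le_rfl)] at hsum
    simp only [Finset.sum_const, smul_eq_mul, ← ha] at hsum
    linarith

open Classical in
/-- Tree maps whose value at `i` is restricted to a set `A i` containing all `j ≤ i`
make up a proportion `1 / n` of all such maps. -/
theorem mul_card_treeMap_restricted {n : ℕ} (hn : 0 < n) {A : Fin n → Finset (Fin n)}
    (hA : ∀ i j, j ≤ i → j ∈ A i) :
    n * (Finset.univ.filter fun f : Fin n → Fin n => IsTreeMap f ∧ ∀ i, f i ∈ A i).card =
      ∏ i, (A i).card := by
  have := card_treeCompletions_of_no_root hA n 0 (by omega) hn id id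
    ⟨fun _ _ => rfl, fun v => ⟨0, fun _ _ => rfl⟩⟩ (by simp)
  simpa [treeCompletions] using this

open Polynomial in
/-- Appending one value to a map into an `n`-element set, on the generating function of image
sizes in the variable `1 + X`. -/
noncomputable def valueStep (n : ℕ) (p : ℤ[X]) : ℤ[X] :=
  (1 + X) * ((n : ℤ[X]) * p - X * derivative p)

open Polynomial in
theorem valueStep_sum {ι : Type*} (n : ℕ) (s : Finset ι) (p : ι → ℤ[X]) :
    valueStep n (∑ i ∈ s, p i) = ∑ i ∈ s, valueStep n (p i) := by
  simp only [valueStep, derivative_sum, Finset.mul_sum, ← Finset.sum_sub_distrib]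

open Polynomial in
theorem valueStep_mul_X_pow (n c : ℕ) (a : ℤ) :
    valueStep n (C a * X ^ c) = (1 + X) * (C (((n : ℤ) - c) * a) * X ^ c) := by
  have h : X * derivative (X ^ c : ℤ[X]) = (c : ℤ[X]) * X ^ c := by
    cases c with
    | zero => simp
    | succ c => simp; ring
  simp only [valueStep, derivative_C_mul]
  rw [mul_left_comm X, h]
  simp only [map_mul, map_sub, map_natCast]
  ring

open Polynomial in
theorem valueStep_one_add_X_pow (n k : ℕ) :
    valueStep n ((1 + X) ^ k) =
      (k : ℤ[X]) * (1 + X) ^ k + ((n : ℤ[X]) - (k : ℤ[X])) * (1 + X) ^ (k + 1) := by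
  have h : (1 + X) * derivative ((1 + X) ^ k : ℤ[X]) = (k : ℤ[X]) * (1 + X) ^ k := by
    cases k with
    | zero => simp
    | succ k => simp [derivative_pow]; ring
  rw [valueStep]
  linear_combination (-X) * h

theorem image_univ_cons {N : ℕ} {α : Type*} [DecidableEq α] (a : α) (f : Fin N → α) :
    Finset.univ.image (Fin.cons a f : Fin (N + 1) → α) = insert a (Finset.univ.image f) := by
  ext b
  simp [Fin.exists_fin_succ, eq_comm]

open Polynomial in
theorem sum_image_succ (n N : ℕ) :
    ∑ f : Fin (N + 1) → Fin n, (1 + X : ℤ[X]) ^ (Finset.univ.image f).card =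
      valueStep n (∑ f : Fin N → Fin n, (1 + X : ℤ[X]) ^ (Finset.univ.image f).card) := by
  rw [valueStep_sum, ← (Fin.consEquiv fun _ => Fin n).sum_comp, Fintype.sum_prod_type_right]
  refine Finset.sum_congr rfl fun f _ => ?_
  rw [valueStep_one_add_X_pow]
  have hterm : ∀ a : Fin n,
      (1 + X : ℤ[X]) ^ (Finset.univ.image ((Fin.consEquiv fun _ => Fin n) (a, f))).card =
        (1 + X) ^ ((Finset.univ.image f).card + 1) +
          if a ∈ Finset.univ.image f then
            (1 + X) ^ (Finset.univ.image f).card - (1 + X) ^ ((Finset.univ.image f).card + 1)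
          else 0 := by
    intro a
    have hcons : (Fin.consEquiv fun _ => Fin n) (a, f) = Fin.cons a f := rfl
    rw [hcons, image_univ_cons, Finset.card_insert_eq_ite]
    split_ifs <;> ring
  rw [Finset.sum_congr rfl fun a _ => hterm a, Finset.sum_add_distrib, ← Finset.sum_filter,
    Finset.sum_const, Finset.sum_const, Finset.filter_mem_eq_inter, Finset.univ_inter]
  simp
  ring

theorem sum_finset_fin_succ {N : ℕ} {M : Type*} [AddCommMonoid M]
    (F : Finset (Fin (N + 1)) → M) :
    ∑ S, F S = ∑ S : Finset (Fin N), (F (S.map (Fin.succEmb N)) +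
      F (insert 0 (S.map (Fin.succEmb N)))) := by
  rw [← Finset.powerset_univ, Fin.univ_succ, Finset.cons_eq_insert,
    Finset.sum_powerset_insert (by simp), Finset.sum_add_distrib, Finset.map_eq_image,
    Finset.powerset_image, Finset.powerset_univ]
  have hinj : Function.Injective (Finset.image (Fin.succ : Fin N → Fin (N + 1))) :=
    Finset.image_injective (Fin.succ_injective N)
  simp only [Finset.map_eq_image, Function.Embedding.coeFn_mk, Fin.coe_succEmb,
    Finset.sum_image hinj.injOn]

open Polynomial in
/-- The generating function, by size of `S`, of the number of maps `f` with `f i ∉ S` or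
`f i ≤ i` for all `i`. -/
theorem sum_finset_prod_succ (n N : ℕ) :
    ∑ S : Finset (Fin (N + 1)),
        C (∏ i, ((n : ℤ) - (S.filter fun j => i < j).card)) * (X : ℤ[X]) ^ S.card =
      valueStep n (∑ S : Finset (Fin N),
        C (∏ i, ((n : ℤ) - (S.filter fun j => i < j).card)) * (X : ℤ[X]) ^ S.card) := by
  rw [valueStep_sum, sum_finset_fin_succ]
  refine Finset.sum_congr rfl fun S _ => ?_
  have h0 : ((S.map (Fin.succEmb N)).filter fun j => 0 < j).card = S.card := by
    rw [Finset.filter_true_of_mem (by simp), Finset.card_map]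
  have hs : ∀ i : Fin N, ((S.map (Fin.succEmb N)).filter fun j => i.succ < j).card =
      (S.filter fun j => i < j).card := by
    intro i
    rw [Finset.filter_map, Finset.card_map]
    simp [Function.comp_def]
  have hm : (0 : Fin (N + 1)) ∉ S.map (Fin.succEmb N) := by simp
  rw [valueStep_mul_X_pow, Fin.prod_univ_succ, Fin.prod_univ_succ, Finset.card_insert_of_notMem hm]
  simp only [Finset.filter_insert, not_lt_zero, if_false, h0, hs, Finset.card_map]
  ring

open Polynomial in
theorem sum_finset_prod_eq_sum_image (n N : ℕ) :
    ∑ S : Finset (Fin N),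
        C (∏ i, ((n : ℤ) - (S.filter fun j => i < j).card)) * (X : ℤ[X]) ^ S.card =
      ∑ f : Fin N → Fin n, (1 + X : ℤ[X]) ^ (Finset.univ.image f).card := by
  induction N with
  | zero => simp [Finset.eq_empty_of_isEmpty]
  | succ N ih => rw [sum_finset_prod_succ, sum_image_succ, ih]

open Polynomial in
theorem one_add_X_pow_card {α : Type*} [DecidableEq α] (s : Finset α) :
    (1 + X : ℤ[X]) ^ s.card = ∑ t ∈ s.powerset, X ^ t.card := by
  have := Finset.prod_one_add (f := fun _ => (X : ℤ[X])) s
  simpa using this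

open Polynomial Classical in
theorem mul_sum_treeMap_eq_sum_image {n : ℕ} (hn : 0 < n) :
    (n : ℤ[X]) * ∑ f : Fin n → Fin n with IsTreeMap f, (1 + X : ℤ[X]) ^ numRuns f =
      ∑ f : Fin n → Fin n, (1 + X : ℤ[X]) ^ (Finset.univ.image f).card := by
  rw [← sum_finset_prod_eq_sum_image]
  have hpow : ∀ f : Fin n → Fin n, (1 + X : ℤ[X]) ^ numRuns f =
      ∑ S : Finset (Fin n), if ∀ j ∈ S, ∀ i, f i = j → j ≤ i then X ^ S.card else 0 := by
    intro f
    rw [numRuns, one_add_X_pow_card, ← Finset.sum_filter]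
    refine Finset.sum_congr ?_ fun _ _ => rfl
    ext S
    simp [Finset.subset_iff]
  simp only [hpow]
  rw [Finset.sum_comm, Finset.mul_sum]
  refine Finset.sum_congr rfl fun S _ => ?_
  have hcard := mul_card_treeMap_restricted hn
    (A := fun i => Finset.univ \ S.filter fun j => i < j)
    (fun i j hij => by simp [hij])
  rw [← Finset.sum_filter, Finset.sum_const, Finset.filter_filter]
  have hset : (Finset.univ.filter fun f : Fin n → Fin n =>
      IsTreeMap f ∧ ∀ j ∈ S, ∀ i, f i = j → j ≤ i) = Finset.univ.filter fun f =>
        IsTreeMap f ∧ ∀ i, f i ∈ Finset.univ \ S.filter fun j => i < j := by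
    refine Finset.filter_congr fun f _ => and_congr_right fun _ => ?_
    simp only [Finset.mem_sdiff, Finset.mem_univ, true_and, Finset.mem_filter, not_and, not_lt]
    exact ⟨fun h i hi => h _ hi i rfl, fun h j hj i hi => hi ▸ h i (hi ▸ hj)⟩
  have hA : ∀ i : Fin n, (((Finset.univ \ S.filter fun j => i < j).card : ℕ) : ℤ) =
      (n : ℤ) - (S.filter fun j => i < j).card := by
    intro i
    rw [Finset.cast_card_sdiff (Finset.subset_univ _), Finset.card_univ, Fintype.card_fin]
  rw [hset, nsmul_eq_mul, ← mul_assoc, ← Nat.cast_mul, hcard]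
  simp [← hA]

open Polynomial in
theorem sum_one_add_X_pow_comp_coeff {α : Type*} (s : Finset α) (a : α → ℕ) (m : ℕ) :
    ((∑ x ∈ s, (1 + X : ℤ[X]) ^ a x).comp (X - 1)).coeff m = (s.filter fun x => a x = m).card := by
  simp [Polynomial.sum_comp, coeff_X_pow, eq_comm]

/-- The number of maps with `m` values in their image is `n` times the number of trees with
`m` ascending runs. -/
theorem mul_treeRunCount_eq_card_image {n : ℕ} (hn : 0 < n) (m : ℕ) :
    n * treeRunCount n m =
      (Finset.univ.filter fun f : Fin n → Fin n => (Finset.univ.image f).card = m).card := by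
  classical
  have h := congrArg (fun p : Polynomial ℤ => (p.comp (Polynomial.X - 1)).coeff m)
    (mul_sum_treeMap_eq_sum_image hn)
  simp only [Polynomial.mul_comp, Polynomial.natCast_comp, Polynomial.coeff_natCast_mul,
    sum_one_add_X_pow_comp_coeff, Finset.filter_filter] at h
  rw [treeRunCount, Nat.card_eq_fintype_card, Fintype.card_subtype]
  exact_mod_cast h

theorem finpartition_ext_part {α : Type*} [DecidableEq α] {s : Finset α} {P Q : Finpartition s}
    (h : ∀ a ∈ s, P.part a = Q.part a) : P = Q := by
  ext t
  have key : ∀ {P Q : Finpartition s}, (∀ a ∈ s, P.part a = Q.part a) →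
      t ∈ P.parts → t ∈ Q.parts := by
    intro P Q h ht
    obtain ⟨a, ha⟩ := P.nonempty_of_mem_parts ht
    have has : a ∈ s := P.le ht ha
    rw [← P.part_eq_of_mem ht ha, h a has]
    exact Q.part_mem.2 has
  exact ⟨key h, key fun a ha => (h a ha).symm⟩

/-- The partition of the domain of `f` into its nonempty fibres. -/
def fibrePartition {α β : Type*} [Fintype α] [DecidableEq α] [DecidableEq β] (f : α → β) :
    Finpartition (Finset.univ : Finset α) :=
  haveI : DecidableRel (Setoid.ker f).r := fun a b => decEq (f a) (f b)
  Finpartition.ofSetoid (Setoid.ker f)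

section fibrePartition

variable {α β : Type*} [Fintype α] [DecidableEq α] [DecidableEq β]

theorem mem_part_fibrePartition {f : α → β} {a b : α} :
    b ∈ (fibrePartition f).part a ↔ f a = f b := by
  unfold fibrePartition
  rw [Finpartition.mem_part_ofSetoid_iff_rel]
  exact Setoid.ker_def

theorem fibrePartition_eq_iff {f : α → β} {P : Finpartition (Finset.univ : Finset α)} :
    fibrePartition f = P ↔ ∀ a b, f a = f b ↔ P.part a = P.part b := by
  have hmem : ∀ a b, b ∈ P.part a ↔ P.part a = P.part b := fun a b => by
    rw [eq_comm, P.part_eq_iff_mem (P.part_mem.2 (Finset.mem_univ a))]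
  constructor
  · rintro rfl a b
    rw [← hmem, mem_part_fibrePartition]
  · refine fun h => finpartition_ext_part fun a _ => ?_
    ext b
    rw [mem_part_fibrePartition, h, hmem]

theorem card_parts_fibrePartition (f : α → β) :
    (fibrePartition f).parts.card = (Finset.univ.image f).card := by
  have h : (fibrePartition f).parts =
      (Finset.univ.image f).image fun y => Finset.univ.filter fun b => y = f b := by
    rw [Finset.image_image]
    rfl
  rw [h, Finset.card_image_of_injOn]
  intro y hy z _ hyz
  obtain ⟨a, -, rfl⟩ := Finset.mem_image.1 hy
  have : a ∈ Finset.univ.filter fun b => z = f b := by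
    have := congrArg (a ∈ ·) hyz
    simpa using this
  simpa [eq_comm] using this

theorem card_fibrePartition_eq [Fintype β] (P : Finpartition (Finset.univ : Finset α)) :
    (Finset.univ.filter fun f : α → β => fibrePartition f = P).card =
      (Fintype.card β).descFactorial P.parts.card := by
  have hP : ∀ a, P.part a ∈ P.parts := fun a => P.part_mem.2 (Finset.mem_univ a)
  rw [← Fintype.card_coe P.parts, ← Fintype.card_embedding_eq, ← Finset.card_univ]
  symm
  refine Finset.card_bij (fun e _ a => e ⟨P.part a, hP a⟩) ?_ ?_ ?_
  · intro e _
    simp [fibrePartition_eq_iff]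
  · intro e _ e' _ h
    ext ⟨t, ht⟩
    obtain ⟨a, ha⟩ := P.nonempty_of_mem_parts ht
    obtain rfl := P.part_eq_of_mem ht ha
    exact congrFun h a
  · intro f hf
    have hf := fibrePartition_eq_iff.1 (Finset.mem_filter.1 hf).2
    choose r hr using fun t : P.parts => P.nonempty_of_mem_parts t.2
    have hr' : ∀ t : P.parts, P.part (r t) = t := fun t => P.part_eq_of_mem t.2 (hr t)
    refine ⟨⟨fun t => f (r t), fun t u h => ?_⟩, Finset.mem_univ _, funext fun a => ?_⟩
    · rw [hf, hr', hr'] at h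
      exact Subtype.ext h
    · exact (hf _ _).2 (hr' _)

end fibrePartition

theorem card_image_eq_descFactorial_mul_stirlingSecond (n m : ℕ) :
    (Finset.univ.filter fun f : Fin n → Fin n => (Finset.univ.image f).card = m).card =
      n.descFactorial m * stirlingSecond n m := by
  classical
  rw [Finset.card_eq_sum_card_fiberwise (f := fibrePartition)
    (t := Finset.univ.filter fun P => P.parts.card = m)]
  · rw [Finset.sum_congr rfl (g := fun _ => n.descFactorial m), Finset.sum_const, smul_eq_mul,
      mul_comm, stirlingSecond, Nat.card_eq_fintype_card, Fintype.card_subtype]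
    intro P hP
    have hP := (Finset.mem_filter.1 hP).2
    rw [Finset.filter_filter, ← hP]
    have hcard := card_fibrePartition_eq (β := Fin n) P
    rw [Fintype.card_fin] at hcard
    rw [← hcard]
    congr 1
    refine Finset.filter_congr fun f _ => and_iff_right_of_imp ?_
    rintro rfl
    exact (card_parts_fibrePartition f).symm
  · intro f hf
    simpa [card_parts_fibrePartition] using hf

/-- The number of Cayley trees of size `n` with exactly `m` ascending runs is
the falling factorial `(n-1)^{\underline{m-1}}` times the Stirling number `S(n,m)`. -/
theorem treeRunCount_eq_descFactorial_mul_stirling (n m : ℕ) (hn : 1 ≤ n) (hm : 1 ≤ m) :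
    treeRunCount n m = (n - 1).descFactorial (m - 1) * stirlingSecond n m := by
  obtain ⟨n, rfl⟩ := Nat.exists_eq_add_of_le' hn
  obtain ⟨m, rfl⟩ := Nat.exists_eq_add_of_le' hm
  refine Nat.eq_of_mul_eq_mul_left (Nat.succ_pos n) ?_
  rw [mul_treeRunCount_eq_card_image hn, card_image_eq_descFactorial_mul_stirlingSecond,
    Nat.succ_descFactorial_succ, Nat.add_sub_cancel, Nat.add_sub_cancel, mul_assoc]
end

section
/- There exists a constant C > 0 such that for all n ≥ 1 and all real x: | n^{−n} · #{ f : Fin n → Fin n : runs(f) ≤ E_n + x·√(V_n) } − Φ(x) | ≤ C·n^{−1/2}, where E_n = n^{−n}·Σ_f runs(f), V_n = n^{−n}·Σ_f runs(f)² − E_n², and Φ(x) = (2π)^{−1/2} ∫_{−∞}^{x} e^{−t²/2} dt is the standard normal distribution function. In other words, the standardized number of ascending runs of a random n-mapping is asymptotically standard normal with rate of convergence O(n^{−1/2}). -/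
open MeasureTheory

/-- The mean number of ascending runs of a uniformly random `n`-mapping. -/
noncomputable def meanRuns (n : ℕ) : ℝ :=
  (∑ f : Fin n → Fin n, (numRuns f : ℝ)) / (n : ℝ) ^ n

/-- The variance of the number of ascending runs of a uniformly random `n`-mapping. -/
noncomputable def varRuns (n : ℕ) : ℝ :=
  (∑ f : Fin n → Fin n, (numRuns f : ℝ) ^ 2) / (n : ℝ) ^ n - (meanRuns n) ^ 2

/-- The cumulative distribution function of the standard normal distribution. -/
noncomputable def stdNormalCDF (x : ℝ) : ℝ :=
  (Real.sqrt (2 * Real.pi))⁻¹ * ∫ t in Set.Iic x, Real.exp (-t ^ 2 / 2)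

open Polynomial

/-- The elements `j < k` all of whose preimages under `g : Fin k → Fin n` are at most `j`. -/
def dominantFinset {k n : ℕ} (g : Fin k → Fin n) : Finset (Fin n) :=
  Finset.univ.filter fun j => (j : ℕ) < k ∧ ∀ i : Fin k, g i = j → (i : ℕ) ≤ j

theorem dominantFinset_snoc {k n : ℕ} (hk : k < n) (g : Fin k → Fin n) (v : Fin n) :
    dominantFinset (Fin.snoc g v : Fin (k + 1) → Fin n) =
      insert ⟨k, hk⟩ ((dominantFinset g).erase v) := by
  ext j
  simp only [dominantFinset, Finset.mem_filter, Finset.mem_univ, true_and, Finset.mem_insert,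
    Finset.mem_erase, Fin.forall_fin_succ', Fin.snoc_castSucc, Fin.snoc_last, Fin.val_castSucc,
    Fin.val_last]
  have hjk : j = ⟨k, hk⟩ ↔ (j : ℕ) = k := Fin.ext_iff
  rw [hjk]
  constructor
  · rintro ⟨hj, hg, hv⟩
    by_cases h : (j : ℕ) = k
    · exact Or.inl h
    · refine Or.inr ⟨fun hjv => ?_, by omega, hg⟩
      have := hv hjv.symm
      omega
  · rintro (h | ⟨hv, hj, hg⟩)
    · refine ⟨by omega, fun i _ => ?_, fun _ => by omega⟩
      have := i.2
      omega
    · exact ⟨by omega, hg, fun h => absurd h.symm hv⟩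

theorem card_dominantFinset_snoc {k n : ℕ} (hk : k < n) (g : Fin k → Fin n) (v : Fin n) :
    (dominantFinset (Fin.snoc g v : Fin (k + 1) → Fin n)).card =
      if v ∈ dominantFinset g then (dominantFinset g).card else (dominantFinset g).card + 1 := by
  have hk' : (⟨k, hk⟩ : Fin n) ∉ (dominantFinset g).erase v := by
    simp [dominantFinset]
  rw [dominantFinset_snoc hk, Finset.card_insert_of_notMem hk']
  split_ifs with h
  · exact Finset.card_erase_add_one h
  · rw [Finset.erase_eq_of_notMem h]

theorem card_dominantFinset_le {k n : ℕ} (g : Fin k → Fin n) : (dominantFinset g).card ≤ n := by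
  simpa using Finset.card_le_univ (dominantFinset g)

theorem sum_dominantFinset_succ {R : Type*} [CommRing R] {k n : ℕ} (hk : k < n) (w : ℕ → R) :
    ∑ g : Fin (k + 1) → Fin n, w (dominantFinset g).card =
      ∑ g : Fin k → Fin n, (((dominantFinset g).card : R) * w (dominantFinset g).card +
        ((n : R) - (dominantFinset g).card) * w ((dominantFinset g).card + 1)) := by
  rw [← (Fin.insertNthEquiv (fun _ => Fin n) (Fin.last k)).sum_comp, Fintype.sum_prod_type_right]
  refine Finset.sum_congr rfl fun g _ => ?_
  have h (v : Fin n) : Fin.insertNthEquiv (fun _ => Fin n) (Fin.last k) (v, g) =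
      (Fin.snoc g v : Fin (k + 1) → Fin n) := Fin.insertNth_last' v g
  simp only [h, card_dominantFinset_snoc hk, apply_ite w]
  rw [Finset.sum_ite, Finset.sum_const, Finset.sum_const, Finset.filter_mem_eq_inter,
    Finset.univ_inter, Finset.filter_notMem_eq_sdiff, ← Finset.compl_eq_univ_sdiff,
    Finset.card_compl, Fintype.card_fin, nsmul_eq_mul, nsmul_eq_mul,
    Nat.cast_sub (card_dominantFinset_le g)]

theorem numRuns_eq_card_dominantFinset {n : ℕ} (f : Fin n → Fin n) :
    numRuns f = (dominantFinset (Fin.rev ∘ f ∘ Fin.rev)).card := by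
  refine Finset.card_bij' (fun j _ => Fin.rev j) (fun j _ => Fin.rev j) ?_ ?_ (by simp) (by simp)
  · intro j hj
    simp only [dominantFinset, Finset.mem_filter, Finset.mem_univ, true_and, Function.comp,
      Fin.rev_inj] at hj ⊢
    refine ⟨Fin.is_lt _, fun i hi => ?_⟩
    have := Fin.rev_le_rev.2 (hj _ hi)
    rwa [Fin.rev_rev] at this
  · intro j hj
    simp only [dominantFinset, Finset.mem_filter, Finset.mem_univ, true_and, Function.comp] at hj ⊢
    intro i hi
    have := hj.2 i.rev (by simp [hi])
    rw [← Fin.rev_le_rev, Fin.rev_rev]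
    exact this

/-- The sum over all `n`-mappings of a function of the number of runs. -/
theorem sum_numRuns {M : Type*} [AddCommMonoid M] (n : ℕ) (w : ℕ → M) :
    ∑ f : Fin n → Fin n, w (numRuns f) = ∑ g : Fin n → Fin n, w (dominantFinset g).card := by
  simp_rw [numRuns_eq_card_dominantFinset]
  exact (Equiv.arrowCongr Fin.revPerm Fin.revPerm).sum_comp
    (fun g : Fin n → Fin n => w (dominantFinset g).card)

/-- The homogenised generating polynomial of `(dominantFinset g).card` over `g : Fin k → Fin n`. -/
noncomputable def dominantPoly (n k : ℕ) : ℝ[X] :=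
  ∑ g : Fin k → Fin n, X ^ (dominantFinset g).card * (1 + X) ^ (n - (dominantFinset g).card)

theorem dominantPoly_succ {n k : ℕ} (hk : k < n) :
    dominantPoly n (k + 1) = X * derivative (dominantPoly n k) := by
  rw [dominantPoly, sum_dominantFinset_succ hk (fun c => (X : ℝ[X]) ^ c * (1 + X) ^ (n - c)),
    dominantPoly, derivative_sum, Finset.mul_sum]
  refine Finset.sum_congr rfl fun g _ => ?_
  obtain ⟨d, hd⟩ := Nat.exists_eq_add_of_le (card_dominantFinset_le g)
  generalize (dominantFinset g).card = c at hd
  subst hd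
  rcases c with _ | c <;> rcases d with _ | d
  · simp
  · simp [derivative_pow_succ]
    ring
  · simp [derivative_pow_succ]
    ring
  · have h1 : c + 1 + (d + 1) - (c + 1) = d + 1 := by omega
    have h2 : c + 1 + (d + 1) - (c + 1 + 1) = d := by omega
    simp [derivative_pow_succ, h1, h2]
    ring

theorem splits_derivative_of_real {p : ℝ[X]} (hp : p.Splits) : (derivative p).Splits := by
  rw [splits_iff_card_roots] at hp ⊢
  have h1 := card_roots_le_derivative p
  have h2 := card_roots' (derivative p)
  have h3 := natDegree_derivative_le p
  rcases Nat.eq_zero_or_pos p.natDegree with h | h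
  · rw [eq_C_of_natDegree_eq_zero h]
    simp
  · omega

theorem dominantPoly_splits {n : ℕ} (hn : 1 ≤ n) {k : ℕ} (hk : k ≤ n) :
    (dominantPoly n k).Splits ∧ (dominantPoly n k).natDegree = n ∧
      (dominantPoly n k).leadingCoeff = (n : ℝ) ^ k := by
  induction k with
  | zero =>
    have h : dominantPoly n 0 = (X + C 1) ^ n := by
      simp [dominantPoly, dominantFinset, add_comm]
    rw [h]
    refine ⟨(Splits.X_add_C 1).pow n, by rw [natDegree_pow, natDegree_X_add_C, mul_one], ?_⟩
    rw [leadingCoeff_pow, leadingCoeff_X_add_C]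
    simp
  | succ k ih =>
    obtain ⟨h1, h2, h3⟩ := ih (by omega)
    have hd : (derivative (dominantPoly n k)).natDegree = n - 1 := by
      rw [natDegree_derivative, h2]
    have hl : (derivative (dominantPoly n k)).leadingCoeff = (n : ℝ) ^ (k + 1) := by
      rw [leadingCoeff, h2] at h3
      rw [leadingCoeff, hd, coeff_derivative, Nat.sub_add_cancel hn, h3, Nat.cast_sub hn]
      push_cast
      ring
    have h0 : derivative (dominantPoly n k) ≠ 0 := by
      rw [← leadingCoeff_ne_zero, hl]
      positivity
    rw [dominantPoly_succ (by omega)]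
    refine ⟨Splits.X.mul (splits_derivative_of_real h1), ?_, ?_⟩
    · rw [natDegree_X_mul h0, hd]
      omega
    · rw [leadingCoeff_mul, leadingCoeff_X, one_mul, hl]

/-- Expectation of `f S` for a sum `S` of independent Bernoulli variables with parameters in `l`. -/
def bernExp : List ℝ → (ℕ → ℝ) → ℝ
  | [], f => f 0
  | p :: l, f => (1 - p) * bernExp l f + p * bernExp l (fun m => f (m + 1))

/-- The functional `h ↦ ∑ i, pᵢ (1 - pᵢ) 𝔼 h (S - ξᵢ)` for a sum `S = ∑ i, ξᵢ` of independent
Bernoulli variables with parameters in `l`. -/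
def steinExp : List ℝ → (ℕ → ℝ) → ℝ
  | [], _ => 0
  | p :: l, h => p * (1 - p) * bernExp l h + (1 - p) * steinExp l h +
      p * steinExp l (fun m => h (m + 1))

/-- The variance of a sum of independent Bernoulli variables with parameters in `l`. -/
def bernVar (l : List ℝ) : ℝ := (l.map fun p => p * (1 - p)).sum

theorem bernVar_cons (p : ℝ) (l : List ℝ) : bernVar (p :: l) = p * (1 - p) + bernVar l := by
  simp [bernVar]

theorem bernExp_add (l : List ℝ) (f g : ℕ → ℝ) :
    bernExp l (fun m => f m + g m) = bernExp l f + bernExp l g := by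
  induction l generalizing f g with
  | nil => rfl
  | cons p l ih => simp only [bernExp, ih]; ring

theorem bernExp_smul (l : List ℝ) (c : ℝ) (f : ℕ → ℝ) :
    bernExp l (fun m => c * f m) = c * bernExp l f := by
  induction l generalizing f with
  | nil => rfl
  | cons p l ih => simp only [bernExp, ih]; ring

theorem bernExp_sub (l : List ℝ) (f g : ℕ → ℝ) :
    bernExp l (fun m => f m - g m) = bernExp l f - bernExp l g := by
  have h := bernExp_add l (fun m => f m - g m) g
  simp only [sub_add_cancel] at h
  linarith

theorem bernExp_const (l : List ℝ) (c : ℝ) : bernExp l (fun _ => c) = c := by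
  induction l with
  | nil => rfl
  | cons p l ih => simp only [bernExp, ih]; ring

theorem steinExp_add (l : List ℝ) (f g : ℕ → ℝ) :
    steinExp l (fun m => f m + g m) = steinExp l f + steinExp l g := by
  induction l generalizing f g with
  | nil => simp [steinExp]
  | cons p l ih => simp only [steinExp, ih, bernExp_add]; ring

theorem steinExp_smul (l : List ℝ) (c : ℝ) (f : ℕ → ℝ) :
    steinExp l (fun m => c * f m) = c * steinExp l f := by
  induction l generalizing f with
  | nil => simp [steinExp]
  | cons p l ih => simp only [steinExp, ih, bernExp_smul]; ring

theorem steinExp_const (l : List ℝ) (c : ℝ) : steinExp l (fun _ => c) = c * bernVar l := by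
  induction l with
  | nil => simp [steinExp, bernVar]
  | cons p l ih => simp only [steinExp, ih, bernExp_const, bernVar_cons]; ring

theorem bernExp_mono {l : List ℝ} (hl : ∀ p ∈ l, p ∈ Set.Icc (0 : ℝ) 1) {f g : ℕ → ℝ}
    (hfg : ∀ m, f m ≤ g m) : bernExp l f ≤ bernExp l g := by
  induction l generalizing f g with
  | nil => exact hfg 0
  | cons p l ih =>
    simp only [List.forall_mem_cons, Set.mem_Icc] at hl ih
    have h1 := ih hl.2 hfg
    have h2 := ih hl.2 (f := fun m => f (m + 1)) (g := fun m => g (m + 1)) fun m => hfg _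
    exact add_le_add (mul_le_mul_of_nonneg_left h1 (by linarith)) (mul_le_mul_of_nonneg_left h2 hl.1.1)

theorem abs_bernExp_le {l : List ℝ} (hl : ∀ p ∈ l, p ∈ Set.Icc (0 : ℝ) 1) {f g : ℕ → ℝ}
    (hfg : ∀ m, |f m| ≤ g m) : |bernExp l f| ≤ bernExp l g := by
  refine abs_le.2 ⟨?_, bernExp_mono hl fun m => (abs_le.1 (hfg m)).2⟩
  have h := bernExp_mono hl (f := fun m => (-1) * g m) (g := f)
    fun m => by linarith [(abs_le.1 (hfg m)).1]
  rw [bernExp_smul] at h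
  linarith

/-- Stein's identity for a sum of independent Bernoulli variables. -/
theorem bernExp_sub_mean_mul (l : List ℝ) (f : ℕ → ℝ) :
    bernExp l (fun m => (m - l.sum) * f m) = steinExp l (fun m => f (m + 1) - f m) := by
  induction l generalizing f with
  | nil => simp [bernExp, steinExp]
  | cons p l ih =>
    have h1 : (fun m : ℕ => ((m : ℝ) - (p + l.sum)) * f m) =
        fun m => (m - l.sum) * f m - p * f m := by funext m; ring
    have h2 : (fun m : ℕ => (((m + 1 : ℕ) : ℝ) - (p + l.sum)) * f (m + 1)) =
        fun m => (m - l.sum) * f (m + 1) + (1 - p) * f (m + 1) := by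
      funext m; push_cast; ring
    simp only [bernExp, steinExp, List.sum_cons]
    rw [h1, h2, bernExp_sub, bernExp_add, bernExp_smul, bernExp_smul, ih, ih (fun m => f (m + 1)),
      bernExp_sub]
    ring

theorem bernExp_sub_mean (l : List ℝ) : bernExp l (fun m => (m - l.sum)) = 0 := by
  have h := bernExp_sub_mean_mul l (fun _ => 1)
  simp only [mul_one, sub_self, steinExp_const, zero_mul] at h
  exact h

theorem bernExp_sub_mean_sq (l : List ℝ) :
    bernExp l (fun m => (m - l.sum) ^ 2) = bernVar l := by
  have h := bernExp_sub_mean_mul l (fun m => m - l.sum)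
  have h2 : (fun m : ℕ => (((m + 1 : ℕ) : ℝ) - l.sum) - (m - l.sum)) = fun _ => 1 := by
    funext m; push_cast; ring
  rw [h2, steinExp_const, one_mul] at h
  simpa only [sq] using h

/-- Comparison of `S` with `S - ξᵢ`. -/
theorem abs_var_mul_bernExp_sub_steinExp_le {l : List ℝ} (hl : ∀ p ∈ l, p ∈ Set.Icc (0 : ℝ) 1)
    {f g b : ℕ → ℝ} (h0 : ∀ m, |f m - g m| ≤ b m) (h1 : ∀ m, |f (m + 1) - g m| ≤ b m) :
    |bernVar l * bernExp l f - steinExp l g| ≤ steinExp l b := by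
  induction l generalizing f g b with
  | nil => simp [bernVar, steinExp]
  | cons p l ih =>
    have hl' : ∀ q ∈ l, q ∈ Set.Icc (0 : ℝ) 1 := fun q hq => hl q (List.mem_cons_of_mem _ hq)
    obtain ⟨hp0, hp1⟩ := hl p List.mem_cons_self
    have a1 := ih hl' h0 h1
    have a2 := ih hl' (f := fun m => f (m + 1)) (g := fun m => g (m + 1)) (b := fun m => b (m + 1))
      (fun m => h0 _) fun m => h1 _
    have b1 := abs_bernExp_le hl' h0
    have b2 := abs_bernExp_le hl' h1
    rw [bernExp_sub] at b1 b2
    have hq : 0 ≤ 1 - p := by linarith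
    rw [abs_le] at a1 a2 b1 b2
    have c1l := mul_le_mul_of_nonneg_left a1.1 hq
    have c1r := mul_le_mul_of_nonneg_left a1.2 hq
    have c2l := mul_le_mul_of_nonneg_left a2.1 hp0
    have c2r := mul_le_mul_of_nonneg_left a2.2 hp0
    have d1l := mul_le_mul_of_nonneg_left b1.1 (mul_nonneg (mul_nonneg hp0 hq) hq)
    have d1r := mul_le_mul_of_nonneg_left b1.2 (mul_nonneg (mul_nonneg hp0 hq) hq)
    have d2l := mul_le_mul_of_nonneg_left b2.1 (mul_nonneg (mul_nonneg hp0 hq) hp0)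
    have d2r := mul_le_mul_of_nonneg_left b2.2 (mul_nonneg (mul_nonneg hp0 hq) hp0)
    simp only [bernExp, steinExp, bernVar_cons]
    rw [abs_le]
    constructor <;> nlinarith

theorem bernExp_abs_sub_mean_le {l : List ℝ} (hl : ∀ p ∈ l, p ∈ Set.Icc (0 : ℝ) 1) {s : ℝ}
    (hs : 0 < s) (hv : bernVar l = s ^ 2) : bernExp l (fun m => |m - l.sum|) ≤ s := by
  have h := bernExp_mono hl (f := fun m => |m - l.sum|)
    (g := fun m => (2 * s)⁻¹ * (m - l.sum) ^ 2 + s / 2) fun m => by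
      rw [← sub_nonneg, ← sq_abs ((m : ℝ) - l.sum)]
      have : (2 * s)⁻¹ * |(m : ℝ) - l.sum| ^ 2 + s / 2 - |(m : ℝ) - l.sum| =
        (|(m : ℝ) - l.sum| - s) ^ 2 * (2 * s)⁻¹ := by field_simp; ring
      rw [this]
      positivity
  rw [bernExp_add, bernExp_smul, bernExp_const, bernExp_sub_mean_sq, hv] at h
  refine h.trans (le_of_eq ?_)
  field_simp
  ring

theorem steinExp_abs_sub_mean_le {l : List ℝ} (hl : ∀ p ∈ l, p ∈ Set.Icc (0 : ℝ) 1) {s : ℝ}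
    (hs : 0 < s) (hv : bernVar l = s ^ 2) :
    steinExp l (fun m => |m - l.sum|) ≤ s ^ 2 * (s + 1) := by
  have h := abs_var_mul_bernExp_sub_steinExp_le hl (f := fun m => |m - l.sum|)
    (g := fun m => |m - l.sum|) (b := fun _ => 1) (fun m => by simp) fun m => by
      refine (abs_abs_sub_abs_le_abs_sub _ _).trans (le_of_eq ?_)
      push_cast
      rw [show (m : ℝ) + 1 - l.sum - (m - l.sum) = 1 by ring, abs_one]
  have h2 := mul_le_mul_of_nonneg_left (bernExp_abs_sub_mean_le hl hs hv) (sq_nonneg s)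
  rw [steinExp_const, hv] at h
  rw [abs_le] at h
  linarith

/-- The law of `S` has no atoms much larger than the inverse standard deviation. -/
theorem steinExp_window_le {l : List ℝ} (hl : ∀ p ∈ l, p ∈ Set.Icc (0 : ℝ) 1) {s : ℝ}
    (hs : 0 < s) (hv : bernVar l = s ^ 2) (a : ℕ) :
    steinExp l (fun m => if a ≤ m ∧ m < a + 2 then 1 else 0) ≤ s := by
  have h := bernExp_sub_mean_mul l
    (fun m => if m ≤ a then -1 else if m < a + 2 then 0 else 1)
  have h2 : (fun m : ℕ => ((if m + 1 ≤ a then -1 else if m + 1 < a + 2 then 0 else 1 : ℝ) -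
      if m ≤ a then -1 else if m < a + 2 then 0 else 1)) =
      fun m => if a ≤ m ∧ m < a + 2 then 1 else 0 := by
    funext m
    split_ifs <;> first | omega | norm_num
  rw [h2] at h
  rw [← h]
  refine (bernExp_mono hl fun m => ?_).trans (bernExp_abs_sub_mean_le hl hs hv)
  refine (le_abs_self _).trans ?_
  rw [abs_mul]
  refine mul_le_of_le_one_right (abs_nonneg _) ?_
  split_ifs <;> simp

/-- Berry–Esseen bound for sums of independent Bernoulli variables, given an approximate solution
`f` of Stein's equation for the indicator of `(-∞, x]`. -/
theorem abs_bernExp_indicator_sub_le {l : List ℝ} (hl : ∀ p ∈ l, p ∈ Set.Icc (0 : ℝ) 1) {s : ℝ}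
    (hs : 1 ≤ s) (hv : bernVar l = s ^ 2) (x c : ℝ) (f : ℝ → ℝ)
    (hf : ∀ a b w : ℝ, a < b → w = a ∨ w = b →
      |w * f w + (if w ≤ x then 1 else 0) - c - (f b - f a) / (b - a)| ≤
        (b - a) * (2 * |a| + 2 * (b - a) + 6) + if a ≤ x ∧ x < b then 4 else 0) :
    |bernExp l (fun m => if (m : ℝ) ≤ l.sum + x * s then 1 else 0) - c| ≤ 16 / s := by
  have hs0 : 0 < s := by linarith
  set w : ℕ → ℝ := fun m => (m - l.sum) / s with hw
  have hwx (m : ℕ) : w m ≤ x ↔ (m : ℝ) ≤ l.sum + x * s := by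
    rw [hw, div_le_iff₀ hs0, sub_le_iff_le_add']
  have hw1 (m : ℕ) : w (m + 1) - w m = 1 / s := by
    simp only [hw]; push_cast; ring
  have hxw (m : ℕ) : x < w (m + 1) ↔ l.sum + x * s < m + 1 := by
    rw [← not_le, hwx, not_le]; push_cast; rfl
  set b : ℕ → ℝ := fun m => (2 / s ^ 2) * |m - l.sum| + ((2 / s ^ 2 + 6 / s) +
    4 * if ⌊l.sum + x * s⌋₊ ≤ m ∧ m < ⌊l.sum + x * s⌋₊ + 2 then 1 else 0) with hb
  have hbound (m : ℕ) (v : ℝ) (hvm : v = w m ∨ v = w (m + 1)) :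
      |v * f v + (if v ≤ x then 1 else 0) - c - s * (f (w (m + 1)) - f (w m))| ≤ b m := by
    have hlt : w m < w (m + 1) := by
      have : 0 < 1 / s := by positivity
      linarith [hw1 m]
    have h := hf (w m) (w (m + 1)) v hlt hvm
    rw [hw1, div_div_eq_mul_div, div_one, mul_comm _ s] at h
    refine h.trans ?_
    have h2 : (if w m ≤ x ∧ x < w (m + 1) then 4 else 0 : ℝ) ≤
        4 * if ⌊l.sum + x * s⌋₊ ≤ m ∧ m < ⌊l.sum + x * s⌋₊ + 2 then 1 else 0 := by
      by_cases hm : w m ≤ x ∧ x < w (m + 1)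
      · have h3 : ⌊l.sum + x * s⌋₊ = m := by
          have h4 := (hwx m).1 hm.1
          exact (Nat.floor_eq_iff ((Nat.cast_nonneg m).trans h4)).2 ⟨h4, (hxw m).1 hm.2⟩
        rw [if_pos hm, h3, if_pos ⟨le_rfl, by omega⟩, mul_one]
      · rw [if_neg hm]
        split_ifs <;> norm_num
    have h3 : 1 / s * (2 * |w m| + 2 * (1 / s) + 6) =
        (2 / s ^ 2) * |m - l.sum| + (2 / s ^ 2 + 6 / s) := by
      rw [hw, abs_div, abs_of_pos hs0]
      field_simp
      ring
    rw [h3, add_assoc]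
    exact add_le_add_right (add_le_add_right h2 _) _
  have key := abs_var_mul_bernExp_sub_steinExp_le hl
    (f := fun m => w m * f (w m) + (if w m ≤ x then 1 else 0) - c)
    (g := fun m => s * (f (w (m + 1)) - f (w m))) (b := b)
    (fun m => hbound m _ (Or.inl rfl)) (fun m => hbound m _ (Or.inr rfl))
  have hstein : s ^ 2 * bernExp l (fun m => w m * f (w m)) =
      steinExp l (fun m => s * (f (w (m + 1)) - f (w m))) := by
    rw [steinExp_smul, ← bernExp_sub_mean_mul l (fun m => f (w m)), ← bernExp_smul, ← bernExp_smul]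
    congr 1
    funext m
    simp only [hw]
    field_simp
  have hb' : steinExp l b ≤ 16 * s := by
    rw [hb, steinExp_add, steinExp_add, steinExp_smul, steinExp_smul, steinExp_const, hv]
    have h1 := mul_le_mul_of_nonneg_left (steinExp_abs_sub_mean_le hl hs0 hv)
      (show 0 ≤ 2 / s ^ 2 by positivity)
    have h2 := steinExp_window_le hl hs0 hv ⌊l.sum + x * s⌋₊
    have h3 : 2 / s ^ 2 * (s ^ 2 * (s + 1)) = 2 * s + 2 := by field_simp
    have h4 : (2 / s ^ 2 + 6 / s) * s ^ 2 = 2 + 6 * s := by field_simp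
    rw [h3] at h1
    rw [h4]
    linarith
  have hsplit : bernExp l (fun m => w m * f (w m) + (if w m ≤ x then 1 else 0) - c) =
      bernExp l (fun m => w m * f (w m)) +
        (bernExp l (fun m => if (m : ℝ) ≤ l.sum + x * s then 1 else 0) - c) := by
    rw [bernExp_sub, bernExp_add, bernExp_const]
    simp only [hwx]
    ring
  rw [hv, hsplit, mul_add, hstein, add_sub_cancel_left, abs_mul, abs_of_pos (by positivity)] at key
  rw [le_div_iff₀ hs0]
  refine le_of_mul_le_mul_left ?_ hs0
  calc s * (|bernExp l (fun m => if (m : ℝ) ≤ l.sum + x * s then 1 else 0) - c| * s)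
      = s ^ 2 * |bernExp l (fun m => if (m : ℝ) ≤ l.sum + x * s then 1 else 0) - c| := by ring
    _ ≤ 16 * s := key.trans hb'
    _ = s * 16 := by ring

/-- The unnormalised lower tail of the standard normal distribution. -/
noncomputable def normalLower (w : ℝ) : ℝ := ∫ t in Set.Iic w, Real.exp (-t ^ 2 / 2)

/-- The unnormalised upper tail of the standard normal distribution. -/
noncomputable def normalUpper (w : ℝ) : ℝ := ∫ t in Set.Ioi w, Real.exp (-t ^ 2 / 2)

theorem integrable_exp_neg_sq_div_two : Integrable fun t : ℝ => Real.exp (-t ^ 2 / 2) := by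
  have h := integrable_exp_neg_mul_sq (b := 1 / 2) (by norm_num)
  refine h.congr (Filter.Eventually.of_forall fun t => ?_)
  simp only
  ring_nf

theorem normalLower_add_normalUpper (w : ℝ) :
    normalLower w + normalUpper w = Real.sqrt (2 * Real.pi) := by
  have h := integral_gaussian (1 / 2)
  have h1 := integral_add_compl (measurableSet_Iic (a := w)) integrable_exp_neg_sq_div_two
  rw [Set.compl_Iic] at h1
  have h2 : (fun t : ℝ => Real.exp (-t ^ 2 / 2)) = fun t => Real.exp (-(1 / 2) * t ^ 2) := by
    funext t
    ring_nf
  rw [normalLower, normalUpper, h1, h2, h]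
  congr 1
  ring

theorem normalLower_nonneg (w : ℝ) : 0 ≤ normalLower w :=
  integral_nonneg fun _ => (Real.exp_pos _).le

theorem normalUpper_nonneg (w : ℝ) : 0 ≤ normalUpper w :=
  integral_nonneg fun _ => (Real.exp_pos _).le

theorem normalLower_mono : Monotone normalLower := fun _ _ hab =>
  setIntegral_mono_set integrable_exp_neg_sq_div_two.integrableOn
    (Filter.Eventually.of_forall fun _ => (Real.exp_pos _).le)
    (Filter.Eventually.of_forall (Set.Iic_subset_Iic.2 hab))

theorem normalUpper_anti : Antitone normalUpper := fun a b hab => by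
  linarith [normalLower_mono hab, normalLower_add_normalUpper a, normalLower_add_normalUpper b]

theorem normalLower_eq_normalUpper_neg (w : ℝ) : normalLower w = normalUpper (-w) := by
  have h := integral_comp_neg_Iic w fun t : ℝ => Real.exp (-t ^ 2 / 2)
  simp only [neg_sq] at h
  exact h

theorem hasDerivAt_normalLower (w : ℝ) :
    HasDerivAt normalLower (Real.exp (-w ^ 2 / 2)) w := by
  have hc : Continuous fun t : ℝ => Real.exp (-t ^ 2 / 2) := by fun_prop
  have h := intervalIntegral.integral_hasDerivAt_right (hc.intervalIntegrable 0 w)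
    (hc.stronglyMeasurableAtFilter _ _) hc.continuousAt
  have h2 : normalLower = fun u => normalLower 0 + ∫ t in (0 : ℝ)..u, Real.exp (-t ^ 2 / 2) := by
    funext u
    have := intervalIntegral.integral_Iic_sub_Iic (a := 0) (b := u)
      integrable_exp_neg_sq_div_two.integrableOn integrable_exp_neg_sq_div_two.integrableOn
    rw [← this, normalLower, normalLower]
    ring
  rw [h2]
  exact h.const_add _

theorem hasDerivAt_normalUpper (w : ℝ) :
    HasDerivAt normalUpper (-Real.exp (-w ^ 2 / 2)) w := by
  have h : normalUpper = fun w => Real.sqrt (2 * Real.pi) - normalLower w := by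
    funext w
    linarith [normalLower_add_normalUpper w]
  rw [h]
  exact (hasDerivAt_normalLower w).const_sub _

theorem mul_normalUpper_le (w : ℝ) : w * normalUpper w ≤ Real.exp (-w ^ 2 / 2) := by
  have hi : Integrable fun t : ℝ => t * Real.exp (-t ^ 2 / 2) := by
    refine (integrable_mul_exp_neg_mul_sq (b := 1 / 2) (by norm_num)).congr
      (Filter.Eventually.of_forall fun t => ?_)
    simp only
    ring_nf
  have hd (t : ℝ) : HasDerivAt (fun t : ℝ => -Real.exp (-t ^ 2 / 2)) (t * Real.exp (-t ^ 2 / 2)) t := by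
    have h := (((hasDerivAt_id t).pow 2).neg.div_const 2).exp.neg
    refine h.congr_deriv ?_
    simp
    ring
  have ht : Filter.Tendsto (fun t : ℝ => -Real.exp (-t ^ 2 / 2)) Filter.atTop (nhds 0) := by
    rw [← neg_zero]
    refine (Real.tendsto_exp_atBot.comp ?_).neg
    have h : (fun t : ℝ => -t ^ 2 / 2) = fun t => -(t ^ 2 / 2) := by funext t; ring
    rw [h]
    exact Filter.tendsto_neg_atTop_atBot.comp
      ((Filter.tendsto_pow_atTop two_ne_zero).atTop_div_const two_pos)
  have h := integral_Ioi_of_hasDerivAt_of_tendsto' (a := w) (fun t _ => hd t) hi.integrableOn ht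
  rw [zero_sub, neg_neg] at h
  rw [← h, normalUpper, ← integral_const_mul]
  exact setIntegral_mono_on (integrable_exp_neg_sq_div_two.const_mul w).integrableOn hi.integrableOn
    measurableSet_Ioi fun t ht => mul_le_mul_of_nonneg_right (le_of_lt ht) (Real.exp_pos _).le

/-- The bounded solution of Stein's equation for the indicator of `(-∞, x]`. -/
noncomputable def steinSol (x w : ℝ) : ℝ :=
  Real.exp (w ^ 2 / 2) * (normalLower (min w x) * normalUpper (max w x)) / Real.sqrt (2 * Real.pi)

theorem sqrt_two_pi_pos : 0 < Real.sqrt (2 * Real.pi) := Real.sqrt_pos.2 (by positivity)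

theorem steinSol_nonneg (x w : ℝ) : 0 ≤ steinSol x w :=
  div_nonneg (mul_nonneg (Real.exp_pos _).le
    (mul_nonneg (normalLower_nonneg _) (normalUpper_nonneg _))) sqrt_two_pi_pos.le

theorem steinSol_le (x w : ℝ) : steinSol x w ≤ Real.exp (w ^ 2 / 2) * normalUpper |w| := by
  have h1 := normalLower_add_normalUpper w
  have h2 : normalLower (min w x) * normalUpper (max w x) ≤ normalLower w * normalUpper w :=
    mul_le_mul (normalLower_mono (min_le_left _ _)) (normalUpper_anti (le_max_left _ _))
      (normalUpper_nonneg _) (normalLower_nonneg _)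
  have h3 : normalLower w * normalUpper w ≤ normalUpper |w| * Real.sqrt (2 * Real.pi) := by
    have hl := normalLower_nonneg w
    have hu := normalUpper_nonneg w
    rcases abs_cases w with h | h
    · rw [h.1]
      nlinarith
    · rw [h.1, ← normalLower_eq_normalUpper_neg]
      nlinarith
  rw [steinSol, div_le_iff₀ sqrt_two_pi_pos, mul_assoc]
  exact mul_le_mul_of_nonneg_left (h2.trans h3) (Real.exp_pos _).le

theorem abs_mul_steinSol_le (x w : ℝ) : |w * steinSol x w| ≤ 1 := by
  rw [abs_mul, abs_of_nonneg (steinSol_nonneg x w)]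
  calc |w| * steinSol x w ≤ |w| * (Real.exp (w ^ 2 / 2) * normalUpper |w|) :=
        mul_le_mul_of_nonneg_left (steinSol_le x w) (abs_nonneg _)
    _ = Real.exp (w ^ 2 / 2) * (|w| * normalUpper |w|) := by ring
    _ ≤ Real.exp (w ^ 2 / 2) * Real.exp (-|w| ^ 2 / 2) :=
        mul_le_mul_of_nonneg_left (mul_normalUpper_le _) (Real.exp_pos _).le
    _ = 1 := by
        rw [← Real.exp_add, sq_abs, ← add_div, add_neg_cancel, zero_div, Real.exp_zero]

theorem steinSol_le_six (x w : ℝ) : steinSol x w ≤ 6 := by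
  rcases le_or_gt 1 |w| with h | h
  · have h1 := abs_mul_steinSol_le x w
    rw [abs_mul, abs_of_nonneg (steinSol_nonneg x w)] at h1
    nlinarith [steinSol_nonneg x w]
  · have h1 : Real.exp (w ^ 2 / 2) ≤ 2 := by
      have h2 : w ^ 2 ≤ 1 := by
        rw [← sq_abs]
        nlinarith [abs_nonneg w]
      have h3 : Real.exp (w ^ 2 / 2) ≤ Real.exp (1 / 2) := Real.exp_le_exp.2 (by linarith)
      have h4 : Real.exp (1 / 2) ^ 2 < 2 ^ 2 := by
        rw [← Real.exp_nat_mul]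
        norm_num
        linarith [Real.exp_one_lt_d9]
      exact h3.trans (lt_of_pow_lt_pow_left₀ 2 (by norm_num) h4).le
    have h2 : normalUpper |w| ≤ 3 := by
      have h3 : Real.sqrt (2 * Real.pi) ≤ 3 := by
        rw [Real.sqrt_le_left (by norm_num)]
        linarith [Real.pi_lt_four]
      linarith [normalLower_add_normalUpper |w|, normalLower_nonneg |w|]
    have h3 := mul_le_mul h1 h2 (normalUpper_nonneg _) zero_le_two
    linarith [steinSol_le x w]

theorem stdNormalCDF_eq (x : ℝ) : stdNormalCDF x = normalLower x / Real.sqrt (2 * Real.pi) := by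
  rw [stdNormalCDF, normalLower, div_eq_inv_mul]

theorem one_sub_stdNormalCDF_eq (x : ℝ) :
    1 - stdNormalCDF x = normalUpper x / Real.sqrt (2 * Real.pi) := by
  rw [stdNormalCDF_eq, eq_div_iff sqrt_two_pi_pos.ne', sub_mul, one_mul,
    div_mul_cancel₀ _ sqrt_two_pi_pos.ne']
  linarith [normalLower_add_normalUpper x]

theorem stdNormalCDF_mem_Icc (x : ℝ) : stdNormalCDF x ∈ Set.Icc (0 : ℝ) 1 := by
  have h1 : 0 ≤ stdNormalCDF x := by
    rw [stdNormalCDF_eq]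
    exact div_nonneg (normalLower_nonneg _) sqrt_two_pi_pos.le
  have h2 : 0 ≤ 1 - stdNormalCDF x := by
    rw [one_sub_stdNormalCDF_eq]
    exact div_nonneg (normalUpper_nonneg _) sqrt_two_pi_pos.le
  exact ⟨h1, by linarith⟩

theorem hasDerivAt_exp_sq_div_two (w : ℝ) :
    HasDerivAt (fun w : ℝ => Real.exp (w ^ 2 / 2)) (w * Real.exp (w ^ 2 / 2)) w := by
  refine (((hasDerivAt_id w).pow 2).div_const 2).exp.congr_deriv ?_
  simp
  ring

theorem exp_sq_mul_exp_neg_sq (w : ℝ) : Real.exp (w ^ 2 / 2) * Real.exp (-w ^ 2 / 2) = 1 := by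
  rw [← Real.exp_add, ← add_div, add_neg_cancel, zero_div, Real.exp_zero]

theorem exists_steinSol_sub_eq_of_le {x a b : ℝ} (hab : a < b) (hb : b ≤ x) :
    ∃ c ∈ Set.Icc a b, (steinSol x b - steinSol x a) / (b - a) =
      c * steinSol x c + (1 - stdNormalCDF x) := by
  have hS (w : ℝ) (hw : w ≤ x) : steinSol x w =
      Real.exp (w ^ 2 / 2) * normalLower w * (normalUpper x / Real.sqrt (2 * Real.pi)) := by
    rw [steinSol, min_eq_left hw, max_eq_right hw]
    ring
  have hd (w : ℝ) : HasDerivAt (fun w => Real.exp (w ^ 2 / 2) * normalLower w *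
      (normalUpper x / Real.sqrt (2 * Real.pi))) (w * (Real.exp (w ^ 2 / 2) * normalLower w *
      (normalUpper x / Real.sqrt (2 * Real.pi))) + normalUpper x / Real.sqrt (2 * Real.pi)) w := by
    refine (((hasDerivAt_exp_sq_div_two w).mul (hasDerivAt_normalLower w)).mul_const _).congr_deriv ?_
    rw [exp_sq_mul_exp_neg_sq]
    ring
  obtain ⟨c, hc, h⟩ := exists_hasDerivAt_eq_slope _ _ hab
    (fun w _ => (hd w).continuousAt.continuousWithinAt) fun w _ => hd w
  refine ⟨c, ⟨hc.1.le, hc.2.le⟩, ?_⟩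
  rw [hS b hb, hS a (hab.le.trans hb), hS c (hc.2.le.trans hb), one_sub_stdNormalCDF_eq, h]

theorem exists_steinSol_sub_eq_of_ge {x a b : ℝ} (hab : a < b) (ha : x ≤ a) :
    ∃ c ∈ Set.Icc a b, (steinSol x b - steinSol x a) / (b - a) =
      c * steinSol x c - stdNormalCDF x := by
  have hS (w : ℝ) (hw : x ≤ w) : steinSol x w =
      Real.exp (w ^ 2 / 2) * normalUpper w * (normalLower x / Real.sqrt (2 * Real.pi)) := by
    rw [steinSol, min_eq_right hw, max_eq_left hw]
    ring
  have hd (w : ℝ) : HasDerivAt (fun w => Real.exp (w ^ 2 / 2) * normalUpper w *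
      (normalLower x / Real.sqrt (2 * Real.pi))) (w * (Real.exp (w ^ 2 / 2) * normalUpper w *
      (normalLower x / Real.sqrt (2 * Real.pi))) - normalLower x / Real.sqrt (2 * Real.pi)) w := by
    refine (((hasDerivAt_exp_sq_div_two w).mul (hasDerivAt_normalUpper w)).mul_const _).congr_deriv ?_
    rw [mul_neg, exp_sq_mul_exp_neg_sq]
    ring
  obtain ⟨c, hc, h⟩ := exists_hasDerivAt_eq_slope _ _ hab
    (fun w _ => (hd w).continuousAt.continuousWithinAt) fun w _ => hd w
  refine ⟨c, ⟨hc.1.le, hc.2.le⟩, ?_⟩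
  rw [hS b (ha.trans hab.le), hS a ha, hS c (ha.trans hc.1.le), stdNormalCDF_eq, h]

theorem abs_steinSol_sub_le (x : ℝ) {a b : ℝ} (hab : a ≤ b) :
    |steinSol x b - steinSol x a| ≤ 2 * (b - a) := by
  obtain ⟨hc0, hc1⟩ := stdNormalCDF_mem_Icc x
  have hle (a b : ℝ) (hab : a ≤ b) (hb : b ≤ x) :
      |steinSol x b - steinSol x a| ≤ 2 * (b - a) := by
    rcases hab.eq_or_lt with rfl | hab
    · simp
    obtain ⟨c, -, h⟩ := exists_steinSol_sub_eq_of_le hab hb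
    have hpos : 0 < b - a := sub_pos.2 hab
    rw [(div_eq_iff hpos.ne').1 h, abs_mul, abs_of_pos hpos]
    refine mul_le_mul_of_nonneg_right ?_ hpos.le
    have := abs_le.1 (abs_mul_steinSol_le x c)
    exact abs_le.2 ⟨by linarith, by linarith⟩
  have hge (a b : ℝ) (hab : a ≤ b) (ha : x ≤ a) :
      |steinSol x b - steinSol x a| ≤ 2 * (b - a) := by
    rcases hab.eq_or_lt with rfl | hab
    · simp
    obtain ⟨c, -, h⟩ := exists_steinSol_sub_eq_of_ge hab ha
    have hpos : 0 < b - a := sub_pos.2 hab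
    rw [(div_eq_iff hpos.ne').1 h, abs_mul, abs_of_pos hpos]
    refine mul_le_mul_of_nonneg_right ?_ hpos.le
    have := abs_le.1 (abs_mul_steinSol_le x c)
    exact abs_le.2 ⟨by linarith, by linarith⟩
  rcases le_total b x with hb | hb
  · exact hle a b hab hb
  rcases le_total x a with ha | ha
  · exact hge a b hab ha
  · have h1 := abs_le.1 (hle a x ha le_rfl)
    have h2 := abs_le.1 (hge x b hb le_rfl)
    exact abs_le.2 ⟨by linarith, by linarith⟩

theorem abs_mul_steinSol_sub_le (x : ℝ) {a b w c : ℝ} (hw : w ∈ Set.Icc a b)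
    (hc : c ∈ Set.Icc a b) :
    |w * steinSol x w - c * steinSol x c| ≤ (b - a) * (2 * |a| + 2 * (b - a) + 6) := by
  have hwc : |w - c| ≤ b - a := abs_le.2 ⟨by linarith [hw.1, hc.2], by linarith [hw.2, hc.1]⟩
  have hS : |steinSol x w - steinSol x c| ≤ 2 * (b - a) := by
    rcases le_total w c with h | h
    · rw [abs_sub_comm]
      linarith [abs_steinSol_sub_le x h, hw.1, hc.2]
    · linarith [abs_steinSol_sub_le x h, hw.2, hc.1]
  have hca : |c| ≤ |a| + (b - a) := by
    have h1 : |c - a| ≤ b - a := abs_le.2 ⟨by linarith [hc.1, hc.2], by linarith [hc.2]⟩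
    linarith [abs_sub_abs_le_abs_sub c a]
  have hb0 : 0 ≤ b - a := (abs_nonneg _).trans hwc
  calc |w * steinSol x w - c * steinSol x c|
      = |(w - c) * steinSol x w + c * (steinSol x w - steinSol x c)| := by ring_nf
    _ ≤ |w - c| * |steinSol x w| + |c| * |steinSol x w - steinSol x c| := by
        rw [← abs_mul, ← abs_mul]
        exact abs_add_le _ _
    _ ≤ (b - a) * 6 + (|a| + (b - a)) * (2 * (b - a)) := by
        rw [abs_of_nonneg (steinSol_nonneg x w)]
        exact add_le_add (mul_le_mul hwc (steinSol_le_six x w) (steinSol_nonneg x w) hb0)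
          (mul_le_mul hca hS (abs_nonneg _) ((abs_nonneg _).trans hca))
    _ = _ := by ring

theorem steinSol_approx (x a b w : ℝ) (hab : a < b) (hw : w = a ∨ w = b) :
    |w * steinSol x w + (if w ≤ x then 1 else 0) - stdNormalCDF x -
        (steinSol x b - steinSol x a) / (b - a)| ≤
      (b - a) * (2 * |a| + 2 * (b - a) + 6) + if a ≤ x ∧ x < b then 4 else 0 := by
  have hwI : w ∈ Set.Icc a b := by
    rcases hw with rfl | rfl
    · exact ⟨le_rfl, hab.le⟩
    · exact ⟨hab.le, le_rfl⟩
  have hpos : 0 < b - a := sub_pos.2 hab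
  rcases le_or_gt b x with hb | hb
  · obtain ⟨c, hc, h⟩ := exists_steinSol_sub_eq_of_le hab hb
    rw [if_pos (hwI.2.trans hb), if_neg (fun h => hb.not_gt h.2), h]
    refine le_trans (le_of_eq ?_) ((abs_mul_steinSol_sub_le x hwI hc).trans_eq (add_zero _).symm)
    ring_nf
  rcases lt_or_ge x a with ha | ha
  · obtain ⟨c, hc, h⟩ := exists_steinSol_sub_eq_of_ge hab ha.le
    rw [if_neg (ha.trans_le hwI.1).not_ge, if_neg (fun h => ha.not_ge h.1), h]
    refine le_trans (le_of_eq ?_) ((abs_mul_steinSol_sub_le x hwI hc).trans_eq (add_zero _).symm)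
    ring_nf
  · rw [if_pos (c := a ≤ x ∧ x < b) ⟨ha, hb⟩]
    have h1 : |(steinSol x b - steinSol x a) / (b - a)| ≤ 2 := by
      rw [abs_div, abs_of_pos hpos, div_le_iff₀ hpos]
      exact abs_steinSol_sub_le x hab.le
    have h2 := abs_mul_steinSol_le x w
    have h3 : 0 ≤ (b - a) * (2 * |a| + 2 * (b - a) + 6) := by positivity
    obtain ⟨hc0, hc1⟩ := stdNormalCDF_mem_Icc x
    rw [abs_le] at h1 h2 ⊢
    split_ifs <;> constructor <;> linarith

/-- The linear functional on polynomials sending `X ^ m` to `w m`. -/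
noncomputable def coeffFunctional (w : ℕ → ℝ) : ℝ[X] →ₗ[ℝ] ℝ :=
  Polynomial.lsum fun m => LinearMap.mulRight ℝ (w m)

theorem coeffFunctional_monomial (w : ℕ → ℝ) (m : ℕ) (a : ℝ) :
    coeffFunctional w (monomial m a) = a * w m := by
  simp [coeffFunctional, Polynomial.lsum_apply]

theorem coeffFunctional_X_mul (w : ℕ → ℝ) (P : ℝ[X]) :
    coeffFunctional w (X * P) = coeffFunctional (fun m => w (m + 1)) P := by
  induction P using Polynomial.induction_on' with
  | add P Q hP hQ => rw [mul_add, map_add, map_add, hP, hQ]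
  | monomial m a => rw [X_mul_monomial, coeffFunctional_monomial, coeffFunctional_monomial]

/-- The probability generating polynomial of a sum of independent Bernoulli variables. -/
noncomputable def bernPoly (l : List ℝ) : ℝ[X] := (l.map fun p => C (1 - p) + C p * X).prod

theorem coeffFunctional_bernPoly (l : List ℝ) (w : ℕ → ℝ) :
    coeffFunctional w (bernPoly l) = bernExp l w := by
  induction l generalizing w with
  | nil =>
    rw [bernPoly, List.map_nil, List.prod_nil, ← monomial_zero_one, coeffFunctional_monomial,
      one_mul, bernExp]
  | cons p l ih =>
    have h : bernPoly (p :: l) = (1 - p) • bernPoly l + p • (X * bernPoly l) := by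
      rw [bernPoly, List.map_cons, List.prod_cons, ← bernPoly, smul_eq_C_mul, smul_eq_C_mul]
      ring
    rw [h, map_add, map_smul, map_smul, coeffFunctional_X_mul, ih, ih, bernExp, smul_eq_mul,
      smul_eq_mul]

theorem eval_dominantPoly (n k : ℕ) (z : ℝ) : (dominantPoly n k).eval z =
    ∑ g : Fin k → Fin n, z ^ (dominantFinset g).card * (1 + z) ^ (n - (dominantFinset g).card) := by
  simp [dominantPoly, eval_finsetSum]

theorem dominantPoly_root_mem_Icc {n k : ℕ} (hn : 1 ≤ n) {z : ℝ}
    (hz : (dominantPoly n k).eval z = 0) : z ∈ Set.Icc (-1 : ℝ) 0 := by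
  have : NeZero n := ⟨by omega⟩
  rw [eval_dominantPoly] at hz
  constructor
  · by_contra! h
    have h1 : 0 < ∑ g : Fin k → Fin n,
        (-z) ^ (dominantFinset g).card * (-(1 + z)) ^ (n - (dominantFinset g).card) :=
      Finset.sum_pos (fun g _ => mul_pos (pow_pos (by linarith) _) (pow_pos (by linarith) _))
        Finset.univ_nonempty
    refine h1.ne' ?_
    have h2 : ∀ g : Fin k → Fin n,
        (-z) ^ (dominantFinset g).card * (-(1 + z)) ^ (n - (dominantFinset g).card) =
        (-1) ^ n * (z ^ (dominantFinset g).card * (1 + z) ^ (n - (dominantFinset g).card)) := by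
      intro g
      rw [neg_pow z, neg_pow (1 + z), ← pow_mul_pow_sub (-1 : ℝ) (card_dominantFinset_le g)]
      ring
    rw [Finset.sum_congr rfl fun g _ => h2 g, ← Finset.mul_sum, hz, mul_zero]
  · by_contra! h
    have h1 : 0 < ∑ g : Fin k → Fin n,
        z ^ (dominantFinset g).card * (1 + z) ^ (n - (dominantFinset g).card) :=
      Finset.sum_pos (fun g _ => by positivity) Finset.univ_nonempty
    exact h1.ne' hz

/-- The number of runs is distributed as a sum of independent Bernoulli variables. -/
theorem exists_sum_numRuns_eq_bernExp {n : ℕ} (hn : 1 ≤ n) :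
    ∃ l : List ℝ, (∀ p ∈ l, p ∈ Set.Icc (0 : ℝ) 1) ∧
      ∀ w : ℕ → ℝ, (∑ f : Fin n → Fin n, w (numRuns f)) / (n : ℝ) ^ n = bernExp l w := by
  obtain ⟨hsplit, hdeg, hlead⟩ := dominantPoly_splits hn le_rfl
  set T := dominantPoly n n with hT
  have hn0 : (n : ℝ) ^ n ≠ 0 := by positivity
  have hT0 : T ≠ 0 := by
    rw [← leadingCoeff_ne_zero, hlead]
    exact hn0
  set l : List ℝ := T.roots.toList.map fun r => 1 + r with hl
  have hlen : l.length = n := by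
    rw [hl, List.length_map, Multiset.length_toList, ← hsplit.natDegree_eq_card_roots, hdeg]
  refine ⟨l, ?_, fun w => ?_⟩
  · intro p hp
    obtain ⟨r, hr, rfl⟩ := List.mem_map.1 hp
    have hr' := (mem_roots hT0).1 (Multiset.mem_toList.1 hr)
    have h := dominantPoly_root_mem_Icc hn hr'
    exact ⟨by linarith [h.1], by linarith [h.2]⟩
  have hpoly : ∑ g : Fin n → Fin n, (X : ℝ[X]) ^ (dominantFinset g).card =
      (n : ℝ) ^ n • bernPoly l := by
    refine eq_of_infinite_eval_eq _ _ ((Set.Iio_infinite (1 : ℝ)).mono fun x hx => ?_)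
    have hx1 : 1 - x ≠ 0 := (sub_pos.2 hx).ne'
    have h1 : (1 - x) ^ n * T.eval (x / (1 - x)) =
        ∑ g : Fin n → Fin n, x ^ (dominantFinset g).card := by
      rw [hT, eval_dominantPoly, Finset.mul_sum]
      refine Finset.sum_congr rfl fun g _ => ?_
      have h2 : 1 + x / (1 - x) = 1 / (1 - x) := by field_simp; ring
      nth_rw 1 [← Nat.add_sub_cancel' (card_dominantFinset_le g)]
      rw [h2, pow_add, div_pow, div_pow, one_pow]
      field_simp
    have h2 : (1 - x) ^ n * T.eval (x / (1 - x)) = (n : ℝ) ^ n * (bernPoly l).eval x := by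
      rw [hsplit.eval_eq_prod_roots, hlead, bernPoly, hl, eval_list_prod]
      have h3 : ∀ L : List ℝ, (1 - x) ^ L.length * (L.map fun r => x / (1 - x) - r).prod =
          (((L.map fun r => 1 + r).map fun p => C (1 - p) + C p * X).map (eval x)).prod := by
        intro L
        induction L with
        | nil => simp
        | cons r L ih =>
          simp only [List.length_cons, List.map_cons, List.prod_cons, ← ih]
          simp only [eval_add, eval_C, eval_mul, eval_X]
          field_simp
          ring
      rw [← h3, Multiset.length_toList, ← hsplit.natDegree_eq_card_roots, hdeg]
      conv_lhs => rw [← Multiset.coe_toList T.roots, Multiset.map_coe, Multiset.prod_coe]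
      ring
    simp only [Set.mem_ofPred_eq, eval_finsetSum, eval_pow, eval_X, eval_smul, smul_eq_mul]
    rw [← h1, h2]
  have h := congrArg (coeffFunctional w) hpoly
  rw [map_sum, map_smul, coeffFunctional_bernPoly, smul_eq_mul] at h
  rw [sum_numRuns, div_eq_iff hn0, mul_comm, ← h]
  refine Finset.sum_congr rfl fun g _ => ?_
  rw [X_pow_eq_monomial, coeffFunctional_monomial, one_mul]

theorem sum_sub_card_dominantFinset {n k : ℕ} (hk : k ≤ n) :
    ∑ g : Fin k → Fin n, ((n : ℝ) - (dominantFinset g).card) = n * ((n : ℝ) - 1) ^ k := by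
  induction k with
  | zero => simp [dominantFinset]
  | succ k ih =>
    rw [sum_dominantFinset_succ hk (fun c => (n : ℝ) - c), pow_succ, ← mul_assoc,
      ← ih (by omega), Finset.sum_mul]
    refine Finset.sum_congr rfl fun g _ => ?_
    push_cast
    ring

theorem sum_descFactorial_sub_card_dominantFinset {n k : ℕ} (hk : k ≤ n) :
    ∑ g : Fin k → Fin n, ((n : ℝ) - (dominantFinset g).card) *
      ((n : ℝ) - (dominantFinset g).card - 1) = n * ((n : ℝ) - 1) * ((n : ℝ) - 2) ^ k := by
  induction k with
  | zero => simp [dominantFinset]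
  | succ k ih =>
    rw [sum_dominantFinset_succ hk (fun c => ((n : ℝ) - c) * ((n : ℝ) - c - 1)), pow_succ,
      ← mul_assoc, ← ih (by omega), Finset.sum_mul]
    refine Finset.sum_congr rfl fun g _ => ?_
    push_cast
    ring

theorem varRuns_eq {n : ℕ} (hn : 1 ≤ n) :
    varRuns n = n * ((n : ℝ) - 1) * (1 - 2 / n) ^ n + n * (1 - 1 / (n : ℝ)) ^ n -
      (n * (1 - 1 / (n : ℝ)) ^ n) ^ 2 := by
  have hn0 : (n : ℝ) ≠ 0 := by positivity
  have hp0 : (n : ℝ) ^ n ≠ 0 := pow_ne_zero _ hn0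
  have h1 := sum_sub_card_dominantFinset (le_refl n)
  have h2 := sum_descFactorial_sub_card_dominantFinset (le_refl n)
  have hone : ∑ g : Fin n → Fin n, (1 : ℝ) = (n : ℝ) ^ n := by simp
  have e1 : (1 - 1 / (n : ℝ)) ^ n = ((n : ℝ) - 1) ^ n / (n : ℝ) ^ n := by
    rw [← div_pow, sub_div, div_self hn0]
  have e2 : (1 - 2 / (n : ℝ)) ^ n = ((n : ℝ) - 2) ^ n / (n : ℝ) ^ n := by
    rw [← div_pow, sub_div, div_self hn0]
  have s1 : ∑ g : Fin n → Fin n, ((dominantFinset g).card : ℝ) =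
      n * (n : ℝ) ^ n - n * ((n : ℝ) - 1) ^ n := by
    rw [← h1, ← hone, Finset.mul_sum, ← Finset.sum_sub_distrib]
    simp
  have s2 : ∑ g : Fin n → Fin n, ((dominantFinset g).card : ℝ) ^ 2 =
      n * ((n : ℝ) - 1) * ((n : ℝ) - 2) ^ n - (n ^ 2 - n) * (n : ℝ) ^ n +
        (2 * n - 1) * ∑ g : Fin n → Fin n, ((dominantFinset g).card : ℝ) := by
    rw [← h2, ← hone, Finset.mul_sum, Finset.mul_sum, ← Finset.sum_sub_distrib,
      ← Finset.sum_add_distrib]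
    refine Finset.sum_congr rfl fun g _ => ?_
    ring
  rw [varRuns, meanRuns, sum_numRuns n (fun c => (c : ℝ) ^ 2), sum_numRuns n (fun c => (c : ℝ)),
    s2, s1, e1, e2]
  field_simp
  ring

theorem div_le_varRuns {n : ℕ} (hn : 5 ≤ n) : (n : ℝ) / 200 ≤ varRuns n := by
  have hn5 : (5 : ℝ) ≤ n := by exact_mod_cast hn
  have hn0 : (0 : ℝ) < n := by linarith
  rw [varRuns_eq (by omega)]
  set u : ℝ := (1 - 1 / (n : ℝ)) ^ n with hu
  set v : ℝ := (1 - 2 / (n : ℝ)) ^ n with hv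
  set a : ℝ := (1 - 1 / (n : ℝ)) ^ 2 with ha
  have hq : 4 / 5 ≤ 1 - 1 / (n : ℝ) := by
    have : 1 / (n : ℝ) ≤ 1 / 5 := one_div_le_one_div_of_le (by norm_num) hn5
    linarith
  have ha1 : 16 / 25 ≤ a := by rw [ha]; nlinarith
  have ha0 : 0 < a := by linarith
  have hua : u ^ 2 = a ^ n := by rw [hu, ha, ← pow_mul, ← pow_mul, mul_comm]
  have hab : 1 - 2 / (n : ℝ) = a * (1 + -(1 / (n ^ 2 * a))) := by
    have h : a * (1 + -(1 / (n ^ 2 * a))) = a - 1 / (n : ℝ) ^ 2 := by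
      field_simp
      ring
    rw [h, ha]
    field_simp
    ring
  have hba : 1 / ((n : ℝ) ^ 2 * a) ≤ 1 := by
    rw [div_le_one (by positivity)]
    nlinarith
  have hvu : v ≤ u ^ 2 := by
    rw [hua, hv, hab]
    have h1 : (0 : ℝ) ≤ 1 / ((n : ℝ) ^ 2 * a) := by positivity
    exact pow_le_pow_left₀ (mul_nonneg ha0.le (by linarith))
      (mul_le_of_le_one_right ha0.le (by linarith)) n
  have huv : u ^ 2 * (1 - 1 / (n * a)) ≤ v := by
    have h := one_add_mul_le_pow (a := -(1 / ((n : ℝ) ^ 2 * a))) (by linarith) n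
    rw [hv, hab, mul_pow, ← hua]
    refine mul_le_mul_of_nonneg_left (le_trans (le_of_eq ?_) h) (sq_nonneg u)
    field_simp
    ring
  have hu1 : u ≤ 0.3679 := by
    have h1 : u ≤ Real.exp (-1) := by
      have h2 := Real.one_sub_div_pow_le_exp_neg (n := n) (t := 1) (by linarith)
      exact h2
    have h2 : Real.exp (-1) ≤ 0.3679 := by linarith [Real.exp_neg_one_lt_d9]
    linarith
  have hu0 : 1 / 9 ≤ u := by
    have h1 : Real.exp (-(2 / n)) ≤ 1 - 1 / (n : ℝ) := by
      rw [Real.exp_neg, inv_le_comm₀ (Real.exp_pos _) (by linarith)]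
      refine le_trans ?_ (Real.add_one_le_exp (2 / (n : ℝ)))
      rw [inv_le_iff_one_le_mul₀ (by linarith)]
      have h3 : (2 / (n : ℝ) + 1) * (1 - 1 / n) = 1 + (n - 2) / n ^ 2 := by field_simp; ring
      have h4 : 0 ≤ ((n : ℝ) - 2) / n ^ 2 := div_nonneg (by linarith) (by positivity)
      linarith
    have h2 : Real.exp (-2) ≤ u := by
      refine le_trans (le_of_eq ?_) (pow_le_pow_left₀ (Real.exp_pos _).le h1 n)
      rw [← Real.exp_nat_mul]
      congr 1
      field_simp
    have h3 : Real.exp 2 ≤ 9 := by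
      have : Real.exp 2 = Real.exp 1 ^ 2 := by rw [← Real.exp_nat_mul]; norm_num
      rw [this]
      nlinarith [Real.exp_one_lt_d9, Real.exp_pos 1]
    refine le_trans ?_ h2
    rw [Real.exp_neg, ← one_div]
    exact one_div_le_one_div_of_le (Real.exp_pos _) h3
  have h1 : n * u * (1 - u - u / a) ≤ n * ((n : ℝ) - 1) * v + n * u - (n * u) ^ 2 := by
    have h2 : (n : ℝ) ^ 2 * (u ^ 2 * (1 - 1 / (n * a))) = n ^ 2 * u ^ 2 - n * u * (u / a) := by
      field_simp
    nlinarith [mul_le_mul_of_nonneg_left huv (sq_nonneg (n : ℝ)),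
      mul_le_mul_of_nonneg_left hvu hn0.le]
  refine le_trans ?_ h1
  have h2 : u / a ≤ 0.575 := by
    rw [div_le_iff₀ ha0]
    nlinarith
  have h3 : 0.0571 ≤ 1 - u - u / a := by linarith
  nlinarith [mul_le_mul hu0 h3 (by norm_num) (by linarith)]

theorem abs_card_numRuns_le_sub_stdNormalCDF_le {n : ℕ} (hn : 1 ≤ n) (hv : 1 ≤ varRuns n) (x : ℝ) :
    |(Nat.card {f : Fin n → Fin n //
        (numRuns f : ℝ) ≤ meanRuns n + x * Real.sqrt (varRuns n)} : ℝ) / (n : ℝ) ^ n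
      - stdNormalCDF x| ≤ 16 / Real.sqrt (varRuns n) := by
  obtain ⟨l, hl, hE⟩ := exists_sum_numRuns_eq_bernExp hn
  have hmean : meanRuns n = l.sum := by
    have h := bernExp_sub_mean l
    rw [bernExp_sub, bernExp_const] at h
    rw [meanRuns, hE (fun c => (c : ℝ))]
    linarith
  have hvar : varRuns n = bernVar l := by
    have h := bernExp_sub_mean_sq l
    have h2 : (fun m : ℕ => ((m : ℝ) - l.sum) ^ 2) =
        fun m : ℕ => ((m : ℝ) ^ 2 - 2 * l.sum * (m - l.sum)) - l.sum ^ 2 := by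
      funext m
      ring
    rw [h2, bernExp_sub, bernExp_sub, bernExp_const, bernExp_smul, bernExp_sub_mean] at h
    rw [varRuns, hmean, hE (fun c => (c : ℝ) ^ 2)]
    linarith
  have hs : bernVar l = Real.sqrt (varRuns n) ^ 2 := by
    rw [Real.sq_sqrt (by linarith), hvar]
  have hcard : (Nat.card {f : Fin n → Fin n //
      (numRuns f : ℝ) ≤ meanRuns n + x * Real.sqrt (varRuns n)} : ℝ) / (n : ℝ) ^ n =
      bernExp l (fun m => if (m : ℝ) ≤ l.sum + x * Real.sqrt (varRuns n) then 1 else 0) := by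
    classical
    rw [← hE, Nat.card_eq_fintype_card, Fintype.card_subtype, Finset.card_filter, ← hmean]
    push_cast
    rfl
  rw [hcard]
  exact abs_bernExp_indicator_sub_le hl (Real.one_le_sqrt.2 hv) hs x _ (steinSol x)
    (steinSol_approx x)

theorem abs_card_div_sub_stdNormalCDF_le_one {n : ℕ} (P : (Fin n → Fin n) → Prop) (x : ℝ) :
    |(Nat.card {f : Fin n → Fin n // P f} : ℝ) / (n : ℝ) ^ n - stdNormalCDF x| ≤ 1 := by
  obtain ⟨h0, h1⟩ := stdNormalCDF_mem_Icc x
  have h2 : (Nat.card {f : Fin n → Fin n // P f} : ℝ) ≤ (n : ℝ) ^ n := by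
    have h := Finite.card_subtype_le P
    rw [Nat.card_eq_fintype_card (α := Fin n → Fin n), Fintype.card_fun, Fintype.card_fin] at h
    exact_mod_cast h
  have h3 : (Nat.card {f : Fin n → Fin n // P f} : ℝ) / (n : ℝ) ^ n ≤ 1 :=
    div_le_one_of_le₀ h2 (by positivity)
  have h4 : 0 ≤ (Nat.card {f : Fin n → Fin n // P f} : ℝ) / (n : ℝ) ^ n := by positivity
  exact abs_le.2 ⟨by linarith, by linarith⟩

/-- Central limit theorem for the number of ascending runs of a random `n`-mapping,
with rate of convergence `O(n^{-1/2})`. -/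
theorem runs_central_limit_theorem :
    ∃ C : ℝ, 0 < C ∧ ∀ n : ℕ, 1 ≤ n → ∀ x : ℝ,
      |(Nat.card {f : Fin n → Fin n //
            (numRuns f : ℝ) ≤ meanRuns n + x * Real.sqrt (varRuns n)} : ℝ) / (n : ℝ) ^ n
          - stdNormalCDF x| ≤ C / Real.sqrt n := by
  refine ⟨300, by norm_num, fun n hn x => ?_⟩
  have hn1 : (1 : ℝ) ≤ n := by exact_mod_cast hn
  have hs0 : 0 < Real.sqrt n := Real.sqrt_pos.2 (by linarith)
  have h15 : Real.sqrt 200 ≤ 15 := by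
    rw [Real.sqrt_le_left (by norm_num)]
    norm_num
  rcases lt_or_ge n 200 with h | h
  · refine (abs_card_div_sub_stdNormalCDF_le_one _ x).trans ?_
    have h1 : Real.sqrt n ≤ Real.sqrt 200 := Real.sqrt_le_sqrt (by exact_mod_cast h.le)
    rw [le_div_iff₀ hs0]
    linarith
  · have hv := div_le_varRuns (n := n) (by omega)
    have hn200 : (200 : ℝ) ≤ n := by exact_mod_cast h
    refine (abs_card_numRuns_le_sub_stdNormalCDF_le hn (by linarith) x).trans ?_
    have h1 : Real.sqrt n / 15 ≤ Real.sqrt (varRuns n) := by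
      refine le_trans ?_ (Real.sqrt_le_sqrt hv)
      rw [Real.sqrt_div (by linarith)]
      exact div_le_div_of_nonneg_left hs0.le (Real.sqrt_pos.2 (by norm_num)) h15
    rw [div_le_div_iff₀ (by linarith [div_pos hs0 (show (0 : ℝ) < 15 by norm_num)]) hs0]
    linarith
end
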